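/- Assuming the axiom of choice for classes, the universal principle LD^sc holds: there is a class function ℓ : Ord → V such that for every supercompact cardinal κ, the restriction ℓ↾κ is a LD^sc_κ Laver function. -/

import Mathlib

open FirstOrder

universe u

namespace LaverDiamond

/-- The relation symbols of the language of set theory: a single binary relation `mem`. -/
inductive memRel : ℕ → Type
  | mem : memRel 2

/-- The first-order language of set theory. -/
def SetLang : FirstOrder.Language := ⟨fun _ => Empty, memRel⟩

/-- Any class of ZF-sets is a structure in the language of set theory, with the true
membership relation. -/
instance classStructure (M : Set ZFSet.{u}) : SetLang.Structure M where
  funMap := fun {_} f _ => f.elim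
  RelMap := fun {_} r x => match r with
    | .mem => (x 0 : ZFSet) ∈ (x 1 : ZFSet)

/-- A (fully) elementary embedding from the class `M` to the class `N`, both classes of
ZF-sets equipped with the true membership relation.  It is coded by a global function
`j : ZFSet → ZFSet` mapping `M` into `N`, elementary for all first-order formulas
with parameters from `M`. -/
structure ClassEmb (M N : Set ZFSet.{u}) where
  j : ZFSet.{u} → ZFSet.{u}
  maps : ∀ x, x ∈ M → j x ∈ N
  elem : ∀ {n : ℕ} (φ : SetLang.Formula (Fin n)) (v : Fin n → ZFSet.{u}) (hv : ∀ i, v i ∈ M),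
    φ.Realize (fun i => (⟨v i, hv i⟩ : M)) ↔ φ.Realize (fun i => (⟨j (v i), maps _ (hv i)⟩ : N))

/-- The universe of all ZF-sets, as a class. -/
def V : Set ZFSet.{u} := Set.univ

/-- A transitive class of ZF-sets. -/
def TransClass (M : Set ZFSet.{u}) : Prop := ∀ x ∈ M, ∀ y ∈ x, y ∈ M

/-- `j` has critical point `κ`: `κ` is an ordinal, fixed below `κ`, with `j(κ) > κ`. -/
def CritPt (j : ZFSet.{u} → ZFSet.{u}) (κ : ZFSet.{u}) : Prop :=
  κ.IsOrdinal ∧ κ ∈ j κ ∧ ∀ α : ZFSet, α.IsOrdinal → α ∈ κ → j α = α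

/-- `x` is a member of the rank-initial segment `V_θ`. -/
def MemV (θ x : ZFSet.{u}) : Prop := x.rank < θ.rank

/-- `κ` is a cardinal: an ordinal not equinumerous with any smaller ordinal. -/
def IsCard (κ : ZFSet.{u}) : Prop :=
  κ.IsOrdinal ∧ ∀ β ∈ κ, Cardinal.mk β.toSet < Cardinal.mk κ.toSet

/-- `x ∈ H(θ⁺)`, i.e. `x` has hereditary size at most `θ`. -/
def MemH (θ x : ZFSet.{u}) : Prop :=
  ∃ t : ZFSet, t.IsTransitive ∧ x ∈ t ∧ Cardinal.mk t.toSet ≤ Cardinal.mk θ.toSet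

/-- `f` is a set-function with domain `θ` taking values in the class `M`. -/
def IsFuncInto (θ : ZFSet.{u}) (M : Set ZFSet.{u}) (f : ZFSet.{u}) : Prop :=
  (∀ p ∈ f, ∃ a b : ZFSet, a ∈ θ ∧ b ∈ M ∧ p = ZFSet.pair a b) ∧
  ∀ a ∈ θ, ∃! b : ZFSet, ZFSet.pair a b ∈ f

/-- The class `M` is closed under `θ`-sequences: `M^θ ⊆ M`. -/
def SeqClosed (θ : ZFSet.{u}) (M : Set ZFSet.{u}) : Prop :=
  ∀ f : ZFSet, IsFuncInto θ M f → f ∈ M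

/-- The set `M` is closed under `<κ`-sequences: `M^{<κ} ⊆ M`. -/
def SeqClosedLt (κ M : ZFSet.{u}) : Prop :=
  ∀ α : ZFSet, α ∈ κ → ∀ f : ZFSet, IsFuncInto α M.toSet f → f ∈ M

/-- `ℓ` is a partial function from `κ` to `V_κ` (coded as a set of Kuratowski pairs). -/
def IsPFun (κ ℓ : ZFSet.{u}) : Prop :=
  (∀ p ∈ ℓ, ∃ γ A : ZFSet, γ ∈ κ ∧ MemV κ A ∧ p = ZFSet.pair γ A) ∧
  ∀ γ A B : ZFSet, ZFSet.pair γ A ∈ ℓ → ZFSet.pair γ B ∈ ℓ → A = B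

/-- The set `r` is the restriction to `κ` of the class function `ℓ` (defined on the
ordinals below `κ`), coded as a set of Kuratowski pairs. -/
def RestrictEq (ℓ : ZFSet.{u} → ZFSet.{u}) (κ r : ZFSet.{u}) : Prop :=
  ∀ p : ZFSet, p ∈ r ↔ ∃ γ : ZFSet, γ ∈ κ ∧ p = ZFSet.pair γ (ℓ γ)

/-- The set `r` is the restriction to `κ` of the class function `ℓ` restricted further to
the class `D`. -/
def RestrictEqOn (ℓ : ZFSet.{u} → ZFSet.{u}) (D : Set ZFSet.{u}) (κ r : ZFSet.{u}) : Prop :=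
  ∀ p : ZFSet, p ∈ r ↔ ∃ γ : ZFSet, γ ∈ κ ∧ γ ∈ D ∧ p = ZFSet.pair γ (ℓ γ)

/-- The set `r` is the restriction to `δ` of the set partial function `ℓ`. -/
def RestrictSet (ℓ δ r : ZFSet.{u}) : Prop :=
  ∀ p : ZFSet, p ∈ r ↔ p ∈ ℓ ∧ ∃ γ A : ZFSet, γ ∈ δ ∧ p = ZFSet.pair γ A

/-! ### Supercompactness -/

/-- A `θ`-supercompactness embedding with critical point `κ`: an elementary embedding
`j : V → M` with `M` a transitive class closed under `θ`-sequences and `j(κ) > θ`. -/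
structure SCEmb (κ θ : ZFSet.{u}) where
  M : Set ZFSet.{u}
  trans : TransClass M
  e : ClassEmb V M
  crit : CritPt e.j κ
  closed : SeqClosed θ M
  big : θ ∈ e.j κ

/-- `κ` is `θ`-supercompact. -/
def SCAt (κ θ : ZFSet.{u}) : Prop := Nonempty (SCEmb κ θ)

/-- `κ` is supercompact: `θ`-supercompact for every cardinal `θ`. -/
def Supercompact (κ : ZFSet.{u}) : Prop := ∀ θ : ZFSet, IsCard θ → SCAt κ θ

/-- `ℓ` is a Laver function witnessing the Laver diamond `LD^sc_κ`. -/
def LDscFun (κ ℓ : ZFSet.{u}) : Prop :=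
  IsPFun κ ℓ ∧ ∀ θ A : ZFSet, IsCard θ → MemH θ A →
    ∃ E : SCEmb κ θ, ZFSet.pair κ A ∈ E.e.j ℓ

/-- The Laver diamond principle `LD^sc_κ`. -/
def LDsc (κ : ZFSet.{u}) : Prop := ∃ ℓ : ZFSet, LDscFun κ ℓ

/-- A universal `LD^sc` Laver function. -/
def UnivLDsc (ℓ : ZFSet.{u} → ZFSet.{u}) : Prop :=
  ∀ κ : ZFSet, Supercompact κ → ∃ r : ZFSet, RestrictEq ℓ κ r ∧ LDscFun κ r

/-! ### Strongness -/

/-- A `θ`-strongness embedding with critical point `κ`: an elementary `j : V → M` with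
`M` a transitive class and `V_θ ⊆ M`. -/
structure StrEmb (κ θ : ZFSet.{u}) where
  M : Set ZFSet.{u}
  trans : TransClass M
  e : ClassEmb V M
  crit : CritPt e.j κ
  vsub : ∀ x : ZFSet, MemV θ x → x ∈ M

/-- `κ` is `θ`-strong. -/
def StrongAt (κ θ : ZFSet.{u}) : Prop := Nonempty (StrEmb κ θ)

/-- `κ` is a strong cardinal. -/
def Strong (κ : ZFSet.{u}) : Prop := ∀ θ : ZFSet, θ.IsOrdinal → StrongAt κ θ

/-- `ℓ` witnesses the Laver diamond `LD^strong_κ`. -/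
def LDstrongFun (κ ℓ : ZFSet.{u}) : Prop :=
  IsPFun κ ℓ ∧ ∀ θ A : ZFSet, θ.IsOrdinal → MemV θ A →
    ∃ E : StrEmb κ θ, ZFSet.pair κ A ∈ E.e.j ℓ

/-- The Laver diamond principle `LD^strong_κ`. -/
def LDstrong (κ : ZFSet.{u}) : Prop := ∃ ℓ : ZFSet, LDstrongFun κ ℓ

/-- A universal `LD^strong` Laver function. -/
def UnivLDstrong (ℓ : ZFSet.{u} → ZFSet.{u}) : Prop :=
  ∀ κ : ZFSet, Strong κ → ∃ r : ZFSet, RestrictEq ℓ κ r ∧ LDstrongFun κ r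

/-! ### Measurability -/

/-- An embedding witnessing measurability of `κ`: an elementary `j : V → M`
with `M` a transitive class and critical point `κ`. -/
structure MeasEmb (κ : ZFSet.{u}) where
  M : Set ZFSet.{u}
  trans : TransClass M
  e : ClassEmb V M
  crit : CritPt e.j κ

/-- `κ` is a measurable cardinal. -/
def MeasurableCard (κ : ZFSet.{u}) : Prop := Nonempty (MeasEmb κ)

/-- `ℓ` witnesses the Laver diamond `LD^meas_κ`. -/
def LDmeasFun (κ ℓ : ZFSet.{u}) : Prop :=
  IsPFun κ ℓ ∧ ∀ A : ZFSet, MemH κ A → ∃ E : MeasEmb κ, ZFSet.pair κ A ∈ E.e.j ℓ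

/-- The Laver diamond principle `LD^meas_κ`. -/
def LDmeas (κ : ZFSet.{u}) : Prop := ∃ ℓ : ZFSet, LDmeasFun κ ℓ

/-- A universal `LD^meas` Laver function. -/
def UnivLDmeas (ℓ : ZFSet.{u} → ZFSet.{u}) : Prop :=
  ∀ κ : ZFSet, MeasurableCard κ → ∃ r : ZFSet, RestrictEq ℓ κ r ∧ LDmeasFun κ r

/-! ### Weak compactness -/

/-- `κ` is weakly compact: every transitive set `M` of size `κ` with `κ ∈ M` admits an
elementary embedding `j : M → N` into a transitive set `N` with critical point `κ`. -/
def WeaklyCompact (κ : ZFSet.{u}) : Prop :=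
  ∀ M : ZFSet, M.IsTransitive → Cardinal.mk M.toSet = Cardinal.mk κ.toSet → κ ∈ M →
    ∃ N : ZFSet, N.IsTransitive ∧ ∃ e : ClassEmb M.toSet N.toSet, CritPt e.j κ

/-- `ℓ` witnesses the Laver diamond `LD^wc_κ`. -/
def LDwcFun (κ ℓ : ZFSet.{u}) : Prop :=
  IsPFun κ ℓ ∧ ∀ A M : ZFSet, MemH κ A →
    M.IsTransitive → Cardinal.mk M.toSet = Cardinal.mk κ.toSet → κ ∈ M → A ∈ M → ℓ ∈ M →
    ∃ N : ZFSet, N.IsTransitive ∧ ∃ e : ClassEmb M.toSet N.toSet,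
      CritPt e.j κ ∧ ZFSet.pair κ A ∈ e.j ℓ

/-- The Laver diamond principle `LD^wc_κ`. -/
def LDwc (κ : ZFSet.{u}) : Prop := ∃ ℓ : ZFSet, LDwcFun κ ℓ

/-- A universal `LD^wc` Laver function. -/
def UnivLDwc (ℓ : ZFSet.{u} → ZFSet.{u}) : Prop :=
  ∀ κ : ZFSet, WeaklyCompact κ → ∃ r : ZFSet, RestrictEq ℓ κ r ∧ LDwcFun κ r

/-! ### Nice structures and unfoldability -/

/-- `M` is a nice structure for `κ`: a transitive set of size `κ`, closed under
`<κ`-sequences, with `κ ∈ M`. -/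
def Nice (κ M : ZFSet.{u}) : Prop :=
  M.IsTransitive ∧ Cardinal.mk M.toSet = Cardinal.mk κ.toSet ∧ SeqClosedLt κ M ∧ κ ∈ M

/-- `κ` is unfoldable: for every ordinal `θ`, every nice structure admits a
`θ`-unfoldability embedding. -/
def Unfoldable (κ : ZFSet.{u}) : Prop :=
  ∀ θ M : ZFSet, θ.IsOrdinal → Nice κ M →
    ∃ N : ZFSet, N.IsTransitive ∧ ∃ e : ClassEmb M.toSet N.toSet, CritPt e.j κ ∧ θ ∈ e.j κ

/-- `ℓ` witnesses the Laver diamond `LD^unf_κ`. -/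
def LDunfFun (κ ℓ : ZFSet.{u}) : Prop :=
  IsPFun κ ℓ ∧ ∀ θ A M : ZFSet, θ.IsOrdinal → MemH κ A →
    M.IsTransitive → Cardinal.mk M.toSet = Cardinal.mk κ.toSet → SeqClosedLt κ M →
    κ ∈ M → ℓ ∈ M → A ∈ M →
    ∃ N : ZFSet, N.IsTransitive ∧ ∃ e : ClassEmb M.toSet N.toSet,
      CritPt e.j κ ∧ θ ∈ e.j κ ∧ ZFSet.pair κ A ∈ e.j ℓ

/-- The Laver diamond principle `LD^unf_κ`. -/
def LDunf (κ : ZFSet.{u}) : Prop := ∃ ℓ : ZFSet, LDunfFun κ ℓ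

/-- `ℓ` witnesses the Laver diamond `LD^sunf_κ` for strong unfoldability. -/
def LDsunfFun (κ ℓ : ZFSet.{u}) : Prop :=
  IsPFun κ ℓ ∧ ∀ θ A M : ZFSet, IsCard θ → MemH θ A →
    M.IsTransitive → Cardinal.mk M.toSet = Cardinal.mk κ.toSet → SeqClosedLt κ M →
    κ ∈ M → ℓ ∈ M →
    ∃ N : ZFSet, N.IsTransitive ∧ (∀ x : ZFSet, MemV θ x → x ∈ N) ∧
      ∃ e : ClassEmb M.toSet N.toSet, CritPt e.j κ ∧ θ ∈ e.j κ ∧ ZFSet.pair κ A ∈ e.j ℓ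

/-! ### Ramsey cardinals -/

/-- `F` is a weakly amenable `M`-normal measure on `κ`. -/
def MNormalMeasure (κ M F : ZFSet.{u}) : Prop :=
  (∀ X ∈ F, X ⊆ κ ∧ X ∈ M) ∧ κ ∈ F ∧ (∅ : ZFSet) ∉ F ∧
  (∀ X Y : ZFSet, X ∈ F → Y ∈ F → X ∩ Y ∈ F) ∧
  (∀ X Y : ZFSet, X ∈ F → Y ∈ M → X ⊆ Y → Y ⊆ κ → Y ∈ F) ∧
  (∀ X : ZFSet, X ∈ M → X ⊆ κ → (X ∈ F ∨ κ \ X ∈ F)) ∧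
  (∀ ξ ∈ κ, ({ξ} : ZFSet) ∉ F) ∧
  (∀ γ f : ZFSet, γ ∈ κ → f ∈ M → IsFuncInto γ F.toSet f →
    ZFSet.sep (fun ξ => ∀ a X : ZFSet, ZFSet.pair a X ∈ f → ξ ∈ X) κ ∈ F) ∧
  (∀ f : ZFSet, f ∈ M → IsFuncInto κ F.toSet f →
    ZFSet.sep (fun ξ => ∀ a X : ZFSet, ZFSet.pair a X ∈ f → a ∈ ξ → ξ ∈ X) κ ∈ F) ∧
  (∀ D : ZFSet, D ∈ M → MemH κ D → F ∩ D ∈ M)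

/-- `j` is (isomorphic to) the ultrapower map of `M` by the `M`-measure `F` on `κ`, with
transitive (wellfounded) target `N`: `j` is elementary, has critical point `κ`, derives the
measure `F` at `κ`, and every element of `N` has the form `j(f)(κ)` for some function
`f ∈ M` with domain `κ`. -/
def IsUltrapowerMap (κ M F N : ZFSet.{u}) (j : ZFSet.{u} → ZFSet.{u}) : Prop :=
  N.IsTransitive ∧ (∃ e : ClassEmb M.toSet N.toSet, e.j = j) ∧ CritPt j κ ∧
  (∀ X : ZFSet, X ∈ M → X ⊆ κ → (X ∈ F ↔ κ ∈ j X)) ∧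
  (∀ y ∈ N, ∃ f : ZFSet, f ∈ M ∧ (∀ a ∈ κ, ∃! b : ZFSet, ZFSet.pair a b ∈ f) ∧
    ZFSet.pair κ y ∈ j f)

/-- A wellfounded iteration of `⟨M, F⟩` of length `δ`: a commuting system of elementary
embeddings between transitive models, starting at `⟨M, F⟩`, taking ultrapowers by the
image measures at successor steps and direct limits at limit stages. -/
structure Iteration (κ M F δ : ZFSet.{u}) where
  Mod : ZFSet.{u} → ZFSet.{u}
  Meas : ZFSet.{u} → ZFSet.{u}
  cp : ZFSet.{u} → ZFSet.{u}
  emb : ZFSet.{u} → ZFSet.{u} → ZFSet.{u} → ZFSet.{u}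
  mod_zero : Mod ∅ = M
  meas_zero : Meas ∅ = F
  cp_zero : cp ∅ = κ
  trans' : ∀ i : ZFSet, i ∈ δ → (Mod i).IsTransitive
  elem' : ∀ i k : ZFSet, i ∈ δ → k ∈ δ → i ∈ k →
    ∃ e : ClassEmb (Mod i).toSet (Mod k).toSet, e.j = emb i k
  comm : ∀ i k l : ZFSet, i ∈ δ → k ∈ δ → l ∈ δ → i ∈ k → k ∈ l →
    ∀ x ∈ Mod i, emb k l (emb i k x) = emb i l x
  cp_emb : ∀ i : ZFSet, i ∈ δ → i ≠ ∅ → cp i = emb ∅ i κ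
  succ' : ∀ i : ZFSet, i ∈ δ → insert i i ∈ δ →
    IsUltrapowerMap (cp i) (Mod i) (Meas i) (Mod (insert i i)) (emb i (insert i i)) ∧
    (∀ Y : ZFSet, Y ∈ Meas (insert i i) ↔
      ∃ D : ZFSet, D ∈ Mod i ∧ Y ∈ emb i (insert i i) (Meas i ∩ D))
  limit' : ∀ l : ZFSet, l ∈ δ → l ≠ ∅ → (∀ i ∈ l, insert i i ∈ l) →
    (∀ y ∈ Mod l, ∃ i : ZFSet, i ∈ l ∧ ∃ x, x ∈ Mod i ∧ emb i l x = y) ∧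
    (∀ Y : ZFSet, Y ∈ Meas l ↔
      ∃ i : ZFSet, i ∈ l ∧ ∃ D, D ∈ Mod i ∧ Y ∈ emb i l (Meas i ∩ D))

/-- `⟨M, F⟩` is iterable: all its iterations (of any ordinal length) are wellfounded,
i.e. realized by transitive models. -/
def Iterable (κ M F : ZFSet.{u}) : Prop :=
  ∀ δ : ZFSet, δ.IsOrdinal → Nonempty (Iteration κ M F δ)

/-! ### Constructibility -/

/-- `X` is a subset of `M` definable over `⟨M, ∈⟩` with parameters. -/
def DefinableSubset (M X : ZFSet.{u}) : Prop :=
  X ⊆ M ∧ ∃ (n : ℕ) (φ : SetLang.Formula (Fin (n + 1))) (v : Fin n → ZFSet.{u})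
    (hv : ∀ i, v i ∈ M.toSet),
    ∀ a : ZFSet, a ∈ X ↔ ∃ ha : a ∈ M.toSet,
      φ.Realize (Fin.cons (⟨a, ha⟩ : M.toSet) (fun i => (⟨v i, hv i⟩ : M.toSet)))

/-- The set of all subsets of `M` definable over `⟨M, ∈⟩` with parameters. -/
noncomputable def DefSet (M : ZFSet.{u}) : ZFSet.{u} :=
  ZFSet.sep (fun X => DefinableSubset M X) (ZFSet.powerset M)

/-- `h` codes the constructible hierarchy up to `δ`: a function with domain `δ` such that
`h(β) = ⋃_{γ<β} Def(h(γ))` for every `β < δ`. -/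
def IsLHierarchy (δ h : ZFSet.{u}) : Prop :=
  δ.IsOrdinal ∧
  (∀ p ∈ h, ∃ β y : ZFSet, β ∈ δ ∧ p = ZFSet.pair β y) ∧
  (∀ β ∈ δ, ∃! y : ZFSet, ZFSet.pair β y ∈ h) ∧
  ∀ β y : ZFSet, ZFSet.pair β y ∈ h →
    ∀ z : ZFSet, z ∈ y ↔ ∃ γ x : ZFSet, γ ∈ β ∧ ZFSet.pair γ x ∈ h ∧ z ∈ DefSet x

/-- `x` is constructible: it appears at some level of some constructible hierarchy. -/
def Constructible (x : ZFSet.{u}) : Prop :=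
  ∃ δ h β y : ZFSet, IsLHierarchy δ h ∧ ZFSet.pair β y ∈ h ∧ x ∈ y

/-- The axiom of constructibility `V = L`. -/
def VeqL : Prop := ∀ x : ZFSet.{u}, Constructible x

/-! ### Normal measures -/

/-- `U` is a normal measure on `κ`: a `κ`-complete nonprincipal ultrafilter on `κ`
closed under diagonal intersections. -/
def IsNormalMeasure (κ U : ZFSet.{u}) : Prop :=
  (∀ X ∈ U, X ⊆ κ) ∧ κ ∈ U ∧ (∅ : ZFSet) ∉ U ∧
  (∀ X Y : ZFSet, X ∈ U → Y ∈ U → X ∩ Y ∈ U) ∧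
  (∀ X Y : ZFSet, X ∈ U → X ⊆ Y → Y ⊆ κ → Y ∈ U) ∧
  (∀ X : ZFSet, X ⊆ κ → (X ∈ U ∨ κ \ X ∈ U)) ∧
  (∀ ξ ∈ κ, ({ξ} : ZFSet) ∉ U) ∧
  (∀ γ f : ZFSet, γ ∈ κ → IsFuncInto γ U.toSet f →
    ZFSet.sep (fun ξ => ∀ a X : ZFSet, ZFSet.pair a X ∈ f → ξ ∈ X) κ ∈ U) ∧
  (∀ f : ZFSet, IsFuncInto κ U.toSet f →
    ZFSet.sep (fun ξ => ∀ a X : ZFSet, ZFSet.pair a X ∈ f → a ∈ ξ → ξ ∈ X) κ ∈ U)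

end LaverDiamond

namespace LaverDiamond

/-- The membership symbol. -/
def memSymb : SetLang.Relations 2 := memRel.mem

/-- A relation on sets, relativized to a class `M`, is uniformly definable if a single first-order
formula defines it in every transitive class. -/
def Dfn (n : ℕ) (R : Set ZFSet.{u} → (Fin n → ZFSet.{u}) → Prop) : Prop :=
  ∃ φ : SetLang.Formula (Fin n), ∀ M : Set ZFSet.{u}, TransClass M → ∀ v : Fin n → M,
    φ.Realize v ↔ R M (fun i => (v i).1)

namespace Dfn

variable {n : ℕ} {R S : Set ZFSet.{u} → (Fin n → ZFSet.{u}) → Prop}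

theorem mem (i j : Fin n) : Dfn.{u} n (fun _ v => v i ∈ v j) :=
  ⟨Language.Relations.formula₂ memSymb (Language.Term.var i)
    (Language.Term.var j), fun M _ v => by
      rw [Language.Formula.realize_rel₂]; rfl⟩

theorem eq (i j : Fin n) : Dfn.{u} n (fun _ v => v i = v j) :=
  ⟨Language.Term.equal (Language.Term.var i) (Language.Term.var j), fun M _ v => by
      rw [Language.Formula.realize_equal]; exact Subtype.ext_iff⟩

theorem not (h : Dfn n R) : Dfn n (fun M v => ¬ R M v) := by
  obtain ⟨φ, h⟩ := h
  exact ⟨φ.not, fun M hM v => by rw [Language.Formula.realize_not, h M hM]⟩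

theorem imp (h : Dfn n R) (h' : Dfn n S) : Dfn n (fun M v => R M v → S M v) := by
  obtain ⟨φ, h⟩ := h
  obtain ⟨ψ, h'⟩ := h'
  exact ⟨φ.imp ψ, fun M hM v => by rw [Language.Formula.realize_imp, h M hM, h' M hM]⟩

theorem congr (h : Dfn n R) (hRS : ∀ M v, TransClass M → (∀ i, v i ∈ M) → (S M v ↔ R M v)) :
    Dfn n S := by
  obtain ⟨φ, h⟩ := h
  exact ⟨φ, fun M hM v => by rw [h M hM, hRS M _ hM fun i => (v i).2]⟩

theorem and (h : Dfn n R) (h' : Dfn n S) : Dfn n (fun M v => R M v ∧ S M v) :=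
  (h.imp h'.not).not.congr fun _ _ _ _ => by tauto

theorem or (h : Dfn n R) (h' : Dfn n S) : Dfn n (fun M v => R M v ∨ S M v) :=
  (h.not.imp h').congr fun _ _ _ _ => by tauto

theorem iff (h : Dfn n R) (h' : Dfn n S) : Dfn n (fun M v => R M v ↔ S M v) :=
  ((h.imp h').and (h'.imp h)).congr fun _ _ _ _ => by tauto

theorem all {Q : Set ZFSet.{u} → (Fin n → ZFSet.{u}) → ZFSet.{u} → Prop}
    (h : Dfn (n + 1) (fun M w => Q M (fun i => w i.castSucc) (w (Fin.last n)))) :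
    Dfn n (fun M v => ∀ x ∈ M, Q M v x) := by
  obtain ⟨φ, h⟩ := h
  refine ⟨(φ.relabel (Fin.lastCases (Sum.inr ()) Sum.inl :
    Fin (n + 1) → Fin n ⊕ Unit)).iAlls Unit, fun M hM v => ?_⟩
  rw [Language.Formula.realize_iAlls]
  simp only [Language.Formula.realize_relabel]
  constructor
  · intro H x hx
    have := (h M hM _).1 (H fun _ => ⟨x, hx⟩)
    simpa [Function.comp_def] using this
  · intro H i
    refine (h M hM _).2 ?_
    simpa [Function.comp_def] using H (i ()).1 (i ()).2

theorem ex {Q : Set ZFSet.{u} → (Fin n → ZFSet.{u}) → ZFSet.{u} → Prop}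
    (h : Dfn (n + 1) (fun M w => Q M (fun i => w i.castSucc) (w (Fin.last n)))) :
    Dfn n (fun M v => ∃ x ∈ M, Q M v x) :=
  (all (Q := fun M v x => ¬ Q M v x) h.not).not.congr fun _ _ _ _ => by push Not; rfl

theorem allb {Q : Set ZFSet.{u} → (Fin n → ZFSet.{u}) → ZFSet.{u} → Prop} (k : Fin n)
    (h : Dfn (n + 1) (fun M w => Q M (fun i => w i.castSucc) (w (Fin.last n)))) :
    Dfn n (fun M v => ∀ x ∈ v k, Q M v x) :=
  (all (Q := fun M v x => x ∈ v k → Q M v x) ((mem _ _).imp h)).congr fun _ _ hM hv =>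
    ⟨fun H x _ hx => H x hx, fun H x hx => H x (hM _ (hv k) x hx) hx⟩

theorem exb {Q : Set ZFSet.{u} → (Fin n → ZFSet.{u}) → ZFSet.{u} → Prop} (k : Fin n)
    (h : Dfn (n + 1) (fun M w => Q M (fun i => w i.castSucc) (w (Fin.last n)))) :
    Dfn n (fun M v => ∃ x ∈ v k, Q M v x) :=
  (allb (Q := fun M v x => ¬ Q M v x) k h.not).not.congr fun _ _ _ _ => by push Not; rfl

theorem subset (i j : Fin n) : Dfn.{u} n (fun _ v => v i ⊆ v j) :=
  (allb i (mem _ _) : Dfn n (fun _ v => ∀ x ∈ v i, x ∈ v j))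

theorem eq_pair (i j k : Fin n) : Dfn.{u} n (fun _ v => v i = ZFSet.pair (v j) (v k)) := by
  have h : Dfn.{u} n (fun _ v => ∀ z ∈ v i,
      (∀ w ∈ z, w = v j) ∧ v j ∈ z ∨ (∀ w ∈ z, w = v j ∨ w = v k) ∧ v j ∈ z ∧ v k ∈ z) :=
    allb _ (((allb _ (eq _ _)).and (mem _ _)).or
      ((allb _ ((eq _ _).or (eq _ _))).and ((mem _ _).and (mem _ _))))
  have h₁ : Dfn.{u} n (fun _ v => ∃ z ∈ v i, (∀ w ∈ z, w = v j) ∧ v j ∈ z) :=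
    exb _ ((allb _ (eq _ _)).and (mem _ _))
  have h₂ : Dfn.{u} n (fun _ v =>
      ∃ z ∈ v i, (∀ w ∈ z, w = v j ∨ w = v k) ∧ v j ∈ z ∧ v k ∈ z) :=
    exb _ ((allb _ ((eq _ _).or (eq _ _))).and ((mem _ _).and (mem _ _)))
  refine (h.and (h₁.and h₂)).congr fun M v _ _ => ?_
  have e₁ (z : ZFSet.{u}) : ((∀ w ∈ z, w = v j) ∧ v j ∈ z) ↔ z = {v j} := by
    constructor
    · rintro ⟨h, h'⟩
      ext w
      rw [ZFSet.mem_singleton]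
      exact ⟨h w, fun e => e ▸ h'⟩
    · rintro rfl; simp
  have e₂ (z : ZFSet.{u}) : ((∀ w ∈ z, w = v j ∨ w = v k) ∧ v j ∈ z ∧ v k ∈ z) ↔
      z = {v j, v k} := by
    constructor
    · rintro ⟨h, h', h''⟩
      ext w
      rw [ZFSet.mem_pair]
      exact ⟨h w, by rintro (rfl | rfl) <;> assumption⟩
    · rintro rfl; simp
  simp only [e₁, e₂]
  constructor
  · intro h
    rw [h, ZFSet.pair]
    simp
  · rintro ⟨h, h₁, h₂⟩
    ext z
    rw [ZFSet.pair, ZFSet.mem_pair]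
    refine ⟨h z, ?_⟩
    rintro (rfl | rfl)
    · obtain ⟨z, hz, rfl⟩ := h₁; exact hz
    · obtain ⟨z, hz, rfl⟩ := h₂; exact hz

theorem pair_mem (i j k : Fin n) : Dfn.{u} n (fun _ v => ZFSet.pair (v i) (v j) ∈ v k) :=
  (exb (Q := fun _ v p => p = ZFSet.pair (v i) (v j)) k (eq_pair _ _ _)).congr
    fun _ _ _ _ => by simp

end Dfn

theorem TransClass.fst_snd_mem {M : Set ZFSet.{u}} (hM : TransClass M) {a b : ZFSet.{u}}
    (h : ZFSet.pair a b ∈ M) : a ∈ M ∧ b ∈ M := by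
  have h' : ({a, b} : ZFSet) ∈ M := hM _ h _ (by simp [ZFSet.pair])
  exact ⟨hM _ h' _ (by simp), hM _ h' _ (by simp)⟩

namespace Dfn

variable {n : ℕ}

theorem all_pair {Q : Set ZFSet.{u} → (Fin n → ZFSet.{u}) → ZFSet.{u} → ZFSet.{u} → Prop}
    (k : Fin n) (h : Dfn (n + 2) (fun M w => Q M (fun i => w i.castSucc.castSucc)
      (w (Fin.last n).castSucc) (w (Fin.last (n + 1))))) :
    Dfn n (fun M v => ∀ a b, ZFSet.pair a b ∈ v k → Q M v a b) :=
  (all (Q := fun M v a => ∀ b ∈ M, ZFSet.pair a b ∈ v k → Q M v a b)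
    (all ((pair_mem _ _ _).imp h))).congr fun _ _ hM hv =>
    ⟨fun H a _ b _ => H a b, fun H a b hab =>
      H a (hM.fst_snd_mem (hM _ (hv k) _ hab)).1 b (hM.fst_snd_mem (hM _ (hv k) _ hab)).2 hab⟩

theorem ex_pair {Q : Set ZFSet.{u} → (Fin n → ZFSet.{u}) → ZFSet.{u} → ZFSet.{u} → Prop}
    (k : Fin n) (h : Dfn (n + 2) (fun M w => Q M (fun i => w i.castSucc.castSucc)
      (w (Fin.last n).castSucc) (w (Fin.last (n + 1))))) :
    Dfn n (fun M v => ∃ a b, ZFSet.pair a b ∈ v k ∧ Q M v a b) :=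
  (all_pair (Q := fun M v a b => ¬ Q M v a b) k h.not).not.congr fun _ _ _ _ => by
    push Not; rfl

theorem ex_eq_pair {Q : Set ZFSet.{u} → (Fin n → ZFSet.{u}) → ZFSet.{u} → ZFSet.{u} → Prop}
    (k : Fin n) (h : Dfn (n + 2) (fun M w => Q M (fun i => w i.castSucc.castSucc)
      (w (Fin.last n).castSucc) (w (Fin.last (n + 1))))) :
    Dfn n (fun M v => ∃ a b, v k = ZFSet.pair a b ∧ Q M v a b) :=
  (ex (Q := fun M v a => ∃ b ∈ M, v k = ZFSet.pair a b ∧ Q M v a b)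
    (ex ((eq_pair _ _ _).and h))).congr fun M v hM hv => by
    constructor
    · rintro ⟨a, b, hab, H⟩
      have := hM.fst_snd_mem (hab ▸ hv k)
      exact ⟨a, this.1, b, this.2, hab, H⟩
    · rintro ⟨a, _, b, _, H⟩
      exact ⟨a, b, H⟩

theorem isTransitive (i : Fin n) : Dfn.{u} n (fun _ v => (v i).IsTransitive) :=
  (allb i (subset _ _) : Dfn n (fun _ v => ∀ x ∈ v i, x ⊆ v i))

theorem isOrdinal (i : Fin n) : Dfn.{u} n (fun _ v => (v i).IsOrdinal) :=
  ((isTransitive i).and (allb (Q := fun _ _ x => x.IsTransitive) i (isTransitive _))).congr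
    fun _ _ _ _ => ZFSet.isOrdinal_iff_forall_mem_isTransitive

/-- Elementary embeddings preserve uniformly definable relations. -/
theorem transfer {R : Set ZFSet.{u} → (Fin n → ZFSet.{u}) → Prop} (h : Dfn n R)
    {M : Set ZFSet.{u}} (hM : TransClass M) (e : ClassEmb V M) (v : Fin n → ZFSet.{u}) :
    R V v ↔ R M (fun i => e.j (v i)) := by
  obtain ⟨φ, h⟩ := h
  rw [← h V (fun _ _ _ _ => trivial) (fun i => ⟨v i, trivial⟩),
    ← h M hM (fun i => ⟨e.j (v i), e.maps _ trivial⟩)]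
  exact e.elem φ v fun _ => trivial

end Dfn

/-- `i` is the collapsing function of a subset of `T`: a relation with domain contained in `T`
such that `i(a) = {i(c) : c ∈ a ∩ dom i}`. -/
def IsCollapse (T i : ZFSet.{u}) : Prop :=
  (∀ p ∈ i, ∃ a b, p = ZFSet.pair a b ∧ a ∈ T) ∧
  ∀ a b, ZFSet.pair a b ∈ i → (∀ v ∈ b, ∃ c ∈ a, ZFSet.pair c v ∈ i) ∧
    ∀ c v, ZFSet.pair c v ∈ i → c ∈ a → v ∈ b

/-- `ρ` is a strictly increasing relation with values for every element of `T`. -/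
def IsRanking (ρ T η : ZFSet.{u}) : Prop :=
  (∀ a ∈ T, ∃ b ∈ η, ZFSet.pair a b ∈ ρ) ∧
  ∀ a b, ZFSet.pair a b ∈ ρ → ∀ a' b', ZFSet.pair a' b' ∈ ρ → a ∈ a' → b ∈ b'

/-- `U` generates an ultrafilter (from the point of view of `M`) on the set `I` of collapsing
functions of subsets of `T`, which is fine, normal and `κ`-complete, and whose ultrapower maps
`κ` above `θ` and sends `f` to a relation containing `(κ, A)`. -/
def Good (M : Set ZFSet.{u}) (I U κ f T θ A : ZFSet.{u}) : Prop :=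
  (∀ i ∈ I, IsCollapse T i) ∧
  (∀ X ∈ U, X ⊆ I) ∧
  (∀ X ∈ U, ∃ i ∈ I, i ∈ X) ∧
  (∀ X ∈ U, ∀ Y ∈ U, ∃ Z ∈ U, Z ⊆ X ∧ Z ⊆ Y) ∧
  (∀ X ∈ M, X ⊆ I → ∃ Y ∈ U, Y ⊆ X ∨ ∀ x ∈ Y, x ∉ X) ∧
  (∀ a ∈ T, ∃ X ∈ U, ∀ i ∈ X, ∃ p ∈ i, ∃ c b, p = ZFSet.pair c b ∧ c = a) ∧
  (∀ g ∈ M, ∀ X ∈ U, (∀ i ∈ X, ∃ b c, ZFSet.pair b c ∈ i ∧ ZFSet.pair i b ∈ g) →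
    ∃ a ∈ T, ∃ Y ∈ U, ∀ i ∈ Y, ZFSet.pair i a ∈ g) ∧
  (∀ α ∈ κ, ∀ g ∈ M, ∀ X ∈ U, (∀ i ∈ X, ∃ b ∈ α, ZFSet.pair i b ∈ g) →
    ∃ b ∈ α, ∃ Y ∈ U, ∀ i ∈ Y, ZFSet.pair i b ∈ g) ∧
  (∃ X ∈ U, ∀ i ∈ X, ∃ t ∈ κ, ZFSet.pair θ t ∈ i) ∧
  ∃ X ∈ U, ∀ i ∈ X, ∃ k a, ZFSet.pair k a ∈ f ∧ ZFSet.pair κ k ∈ i ∧ ZFSet.pair A a ∈ i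

/-- `(T, θ, A)` is, in `M`, a counterexample of rank at most `η` to `f` being a Laver function
at `γ`. -/
def CounterEx (M : Set ZFSet.{u}) (γ f η T θ A : ZFSet.{u}) : Prop :=
  (η.IsOrdinal ∧ θ.IsOrdinal ∧ T.IsTransitive ∧ γ ∈ T ∧ θ ∈ T ∧ A ∈ T ∧ γ ∈ θ) ∧
  (∃ ρ ∈ M, IsRanking ρ T η) ∧ ¬ ∃ I ∈ M, ∃ U ∈ M, Good M I U γ f T θ A

/-- In `M`, there is a counterexample of rank at most `η` at `γ`. -/
def HasCounterEx (M : Set ZFSet.{u}) (γ f η : ZFSet.{u}) : Prop :=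
  ∃ T ∈ M, ∃ θ ∈ M, ∃ A ∈ M, CounterEx M γ f η T θ A

/-- In `M`, the set `A` is part of a counterexample at `γ` of least possible rank. -/
def MinCounterEx (M : Set ZFSet.{u}) (γ f A : ZFSet.{u}) : Prop :=
  ∃ η ∈ M, (∃ T ∈ M, ∃ θ ∈ M, CounterEx M γ f η T θ A) ∧
    ∀ ξ ∈ M, HasCounterEx M γ f ξ → ξ ∉ η

/-- `f` is the restriction to `γ` of the relation `r`. -/
def IsRes (r γ f : ZFSet.{u}) : Prop :=
  (∀ p ∈ f, p ∈ r ∧ ∃ δ A, p = ZFSet.pair δ A ∧ δ ∈ γ) ∧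
  ∀ δ A, ZFSet.pair δ A ∈ r → δ ∈ γ → ZFSet.pair δ A ∈ f

/-- In `M`, every value of `r` at a point with a counterexample is a minimal counterexample. -/
def IsMenas (M : Set ZFSet.{u}) (r : ZFSet.{u}) : Prop :=
  ∀ γ A, ZFSet.pair γ A ∈ r → ∀ f ∈ M, IsRes r γ f →
    (∃ η ∈ M, HasCounterEx M γ f η) → MinCounterEx M γ f A

namespace Dfn

variable {n : ℕ}

theorem isCollapse (i j : Fin n) : Dfn.{u} n (fun _ v => IsCollapse (v i) (v j)) := by
  unfold IsCollapse
  repeat' first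
    | apply and | apply allb | apply all_pair | apply exb | apply ex_eq_pair
    | apply mem | apply pair_mem | apply imp

theorem isRanking (i j k : Fin n) : Dfn.{u} n (fun _ v => IsRanking (v i) (v j) (v k)) := by
  unfold IsRanking
  repeat' first
    | apply and | apply allb | apply all_pair | apply exb
    | apply mem | apply pair_mem | apply imp

theorem good (i₁ i₂ i₃ i₄ i₅ i₆ i₇ : Fin n) : Dfn.{u} n (fun M v =>
    Good M (v i₁) (v i₂) (v i₃) (v i₄) (v i₅) (v i₆) (v i₇)) := by
  unfold Good
  repeat' first
    | apply isCollapse | apply and | apply or | apply allb | apply exb | apply subset | apply mem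
    | apply pair_mem | apply eq | apply not | apply all | apply ex_eq_pair | apply ex_pair
    | apply imp

theorem counterEx (i₁ i₂ i₃ i₄ i₅ i₆ : Fin n) : Dfn.{u} n (fun M v =>
    CounterEx M (v i₁) (v i₂) (v i₃) (v i₄) (v i₅) (v i₆)) := by
  unfold CounterEx
  repeat' first
    | apply isRanking | apply good | apply isTransitive | apply isOrdinal | apply mem
    | apply and | apply ex | apply not

theorem hasCounterEx (i₁ i₂ i₃ : Fin n) : Dfn.{u} n (fun M v =>
    HasCounterEx M (v i₁) (v i₂) (v i₃)) := by
  unfold HasCounterEx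
  repeat' first | apply counterEx | apply ex

theorem minCounterEx (i₁ i₂ i₃ : Fin n) : Dfn.{u} n (fun M v =>
    MinCounterEx M (v i₁) (v i₂) (v i₃)) := by
  unfold MinCounterEx
  repeat' first
    | apply counterEx | apply hasCounterEx | apply mem | apply and | apply not | apply ex
    | apply all | apply imp

theorem isRes (i₁ i₂ i₃ : Fin n) : Dfn.{u} n (fun _ v => IsRes (v i₁) (v i₂) (v i₃)) := by
  unfold IsRes
  repeat' first
    | apply mem | apply pair_mem | apply and | apply allb | apply ex_eq_pair | apply all_pair
    | apply imp

theorem isMenas (i : Fin n) : Dfn.{u} n (fun M v => IsMenas M (v i)) := by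
  unfold IsMenas
  repeat' first
    | apply hasCounterEx | apply minCounterEx | apply isRes | apply all_pair
    | apply ex | apply all | apply imp

end Dfn

/-- The graph of `F` on the set `D`. -/
noncomputable def graph (D : ZFSet.{u}) (F : ZFSet.{u} → ZFSet.{u}) : ZFSet.{u} :=
  ZFSet.range fun a : D => ZFSet.pair a (F a)

theorem mem_graph {D p : ZFSet.{u}} {F : ZFSet.{u} → ZFSet.{u}} :
    p ∈ graph D F ↔ ∃ a ∈ D, p = ZFSet.pair a (F a) := by
  simp [graph, eq_comm]

theorem pair_mem_graph {D a b : ZFSet.{u}} {F : ZFSet.{u} → ZFSet.{u}} :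
    ZFSet.pair a b ∈ graph D F ↔ a ∈ D ∧ b = F a := by
  rw [mem_graph]
  constructor
  · rintro ⟨c, hc, h⟩
    obtain ⟨rfl, rfl⟩ := ZFSet.pair_injective h
    exact ⟨hc, rfl⟩
  · rintro ⟨h, rfl⟩
    exact ⟨a, h, rfl⟩

theorem rank_pair_lt {a b : ZFSet.{u}} {o : Ordinal.{u}} (ho : Order.IsSuccLimit o)
    (ha : a.rank < o) (hb : b.rank < o) : (ZFSet.pair a b).rank < o := by
  simp only [ZFSet.pair, ZFSet.rank_pair, ZFSet.rank_singleton]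
  simpa [← Order.succ_eq_add_one, ho.succ_lt_iff] using ⟨ha, hb⟩

namespace ClassEmb

variable {M : Set ZFSet.{u}} (hM : TransClass M) (e : ClassEmb V M) {κ : ZFSet.{u}}
include hM

theorem mem_iff (x y : ZFSet.{u}) : e.j x ∈ e.j y ↔ x ∈ y :=
  ((Dfn.mem 0 1).transfer hM e ![x, y]).symm

theorem pair (x y : ZFSet.{u}) : e.j (ZFSet.pair x y) = ZFSet.pair (e.j x) (e.j y) :=
  ((Dfn.eq_pair 0 1 2).transfer hM e ![ZFSet.pair x y, x, y]).1 rfl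

theorem pair_mem_iff (x y z : ZFSet.{u}) : ZFSet.pair (e.j x) (e.j y) ∈ e.j z ↔
    ZFSet.pair x y ∈ z := by
  rw [← e.pair hM, e.mem_iff hM]

theorem isOrdinal_iff (x : ZFSet.{u}) : (e.j x).IsOrdinal ↔ x.IsOrdinal :=
  ((Dfn.isOrdinal 0).transfer hM e ![x]).symm

theorem empty : e.j ∅ = ∅ := by
  have := ((Dfn.allb (n := 1) (Q := fun _ _ a => ¬ a = a) 0 (Dfn.eq _ _).not).transfer hM e
    ![∅]).1 (by simp)
  exact (ZFSet.eq_empty _).2 fun y hy => this y hy rfl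

theorem insert_eq (x : ZFSet.{u}) : e.j (insert x x) = insert (e.j x) (e.j x) := by
  have h := ((Dfn.and (n := 2) ((Dfn.allb (Q := fun _ v a => a = v 0 ∨ a ∈ v 0) 1
    ((Dfn.eq _ 0).or (Dfn.mem _ 0))))
    ((Dfn.mem 0 1).and (Dfn.subset 0 1))).transfer hM e ![x, insert x x]).1
      ⟨by simp, by simp, fun a => by simp +contextual⟩
  ext a
  rw [ZFSet.mem_insert_iff]
  exact ⟨fun ha => h.1 a ha, fun ha => ha.elim (fun h' => h' ▸ h.2.1) fun h' => h.2.2 h'⟩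

end ClassEmb

theorem IsRanking.rank_le {ρ T η : ZFSet.{u}} (hT : T.IsTransitive) (h : IsRanking ρ T η)
    (a : ZFSet.{u}) : a ∈ T → ∀ b, ZFSet.pair a b ∈ ρ → a.rank ≤ b.rank := by
  induction a using ZFSet.inductionOn with
  | _ a ih =>
    intro ha b hb
    rw [ZFSet.rank_le_iff]
    intro y hy
    have hyT := hT.subset_of_mem ha hy
    obtain ⟨c, -, hc⟩ := h.1 y hyT
    exact (ih y hy hyT c hc).trans_lt (ZFSet.rank_lt_of_mem (h.2 _ _ hc _ _ hb hy))

theorem IsRanking.rank_lt {ρ T η : ZFSet.{u}} (hT : T.IsTransitive) (h : IsRanking ρ T η)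
    {a : ZFSet.{u}} (ha : a ∈ T) : a.rank < η.rank := by
  obtain ⟨b, hb, hab⟩ := h.1 a ha
  exact (h.rank_le hT a ha b hab).trans_lt (ZFSet.rank_lt_of_mem hb)

theorem isRanking_graph {T η : ZFSet.{u}} (hη : η.IsOrdinal) (h : T.rank ≤ η.rank) :
    IsRanking (graph T fun a => a.rank.toZFSet) T η := by
  refine ⟨fun a ha => ⟨a.rank.toZFSet, ?_, pair_mem_graph.2 ⟨ha, rfl⟩⟩, ?_⟩
  · rw [← ZFSet.IsOrdinal.rank_lt_iff_mem (ZFSet.isOrdinal_toZFSet _) hη, Ordinal.rank_toZFSet]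
    exact (ZFSet.rank_lt_of_mem ha).trans_le h
  · intro a b hab a' b' hab' haa'
    obtain ⟨-, rfl⟩ := pair_mem_graph.1 hab
    obtain ⟨-, rfl⟩ := pair_mem_graph.1 hab'
    exact Ordinal.toZFSet_mem_toZFSet_iff.2 (ZFSet.rank_lt_of_mem haa')

/-- An elementary embedding with critical point `κ` fixes every element of `V_κ`. -/
theorem ClassEmb.fix_of_rank_lt {M : Set ZFSet.{u}} (hM : TransClass M) (e : ClassEmb V M)
    {κ : ZFSet.{u}} (hκ : CritPt e.j κ) (x : ZFSet.{u}) (hx : x.rank < κ.rank) : e.j x = x := by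
  induction h : x.rank using WellFoundedLT.induction generalizing x with
  | _ o ih =>
    subst h
    have ho : x.rank.toZFSet ∈ κ := by
      rwa [← ZFSet.IsOrdinal.rank_lt_iff_mem (ZFSet.isOrdinal_toZFSet _) hκ.1, Ordinal.rank_toZFSet]
    have hS : Dfn.{u} 2 (fun M v => ∃ t ∈ M, ∃ ρ ∈ M, t.IsTransitive ∧ v 0 ⊆ t ∧
        IsRanking ρ t (v 1)) := by
      repeat' first
        | apply Dfn.isRanking | apply Dfn.isTransitive | apply Dfn.subset _ _ | apply Dfn.and
        | apply Dfn.ex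
    obtain ⟨t, -, ρ, -, ht, hxt, hρ⟩ := (hS.transfer hM e ![x, x.rank.toZFSet]).1
      ⟨ZFSet.vonNeumann x.rank, trivial, _, trivial, ZFSet.isTransitive_vonNeumann _,
        ZFSet.subset_vonNeumann_self x, isRanking_graph (ZFSet.isOrdinal_toZFSet _) (by simp)⟩
    change e.j x ⊆ t at hxt
    change IsRanking ρ t (e.j x.rank.toZFSet) at hρ
    rw [hκ.2.2 _ (ZFSet.isOrdinal_toZFSet _) ho] at hρ
    ext y
    constructor
    · intro hy
      have := hρ.rank_lt ht (hxt hy)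
      rw [Ordinal.rank_toZFSet] at this
      rwa [← e.mem_iff hM, ih _ this y (this.trans hx) rfl]
    · intro hy
      have := ZFSet.rank_lt_of_mem hy
      rwa [← e.mem_iff hM, ih _ this y (this.trans hx) rfl] at hy

/-- The properties of `ω` that determine it. -/
def IsOmega (w : ZFSet.{u}) : Prop :=
  w.IsOrdinal ∧ (∃ x, x ∈ w) ∧ (∀ x ∈ w, ∃ y ∈ w, x ∈ y) ∧
    ∀ x ∈ w, (∃ y, y ∈ x) → ∃ y ∈ x, ∀ z ∈ x, y ∉ z

theorem IsOmega.unique {w w' : ZFSet.{u}} (h : IsOmega w) (h' : IsOmega w') : w = w' := by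
  have key : ∀ {w w' : ZFSet.{u}}, IsOmega w → IsOmega w' → w ∉ w' := by
    intro w w' h h' hw
    obtain ⟨y, hy, hy'⟩ := h'.2.2.2 w hw h.2.1
    obtain ⟨z, hz, hz'⟩ := h.2.2.1 y hy
    exact hy' z hz hz'
  rcases h.1.mem_trichotomous h'.1 with H | H | H
  exacts [(key h h' H).elim, H, (key h' h H).elim]

theorem isOmega_omega : IsOmega.{u} Ordinal.omega0.toZFSet := by
  refine ⟨ZFSet.isOrdinal_toZFSet _, ⟨_, Ordinal.toZFSet_mem_toZFSet_iff.2 Ordinal.omega0_pos⟩,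
    ?_, ?_⟩
  · intro x hx
    obtain ⟨a, ha, rfl⟩ := Ordinal.mem_toZFSet_iff.1 hx
    exact ⟨_, Ordinal.toZFSet_mem_toZFSet_iff.2 (Ordinal.isSuccLimit_omega0.succ_lt ha),
      Ordinal.toZFSet_mem_toZFSet_iff.2 (Order.lt_succ a)⟩
  · intro x hx hy
    obtain ⟨a, ha, rfl⟩ := Ordinal.mem_toZFSet_iff.1 hx
    obtain ⟨n, rfl⟩ := Ordinal.lt_omega0.1 ha
    obtain ⟨y, hy⟩ := hy
    obtain ⟨b, hb, rfl⟩ := Ordinal.mem_toZFSet_iff.1 hy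
    cases n with
    | zero => simp at hb
    | succ n =>
      refine ⟨(n : Ordinal).toZFSet, Ordinal.toZFSet_mem_toZFSet_iff.2 (by simp), fun z hz => ?_⟩
      obtain ⟨c, hc, rfl⟩ := Ordinal.mem_toZFSet_iff.1 hz
      rw [Ordinal.toZFSet_mem_toZFSet_iff, not_lt]
      push_cast at hc
      exact Order.lt_add_one_iff.1 hc

/-- A critical point is greater than `ω`. -/
theorem omega_mem_crit {M : Set ZFSet.{u}} (hM : TransClass M) (e : ClassEmb V M)
    {κ : ZFSet.{u}} (hκ : CritPt e.j κ) : Ordinal.omega0.toZFSet ∈ κ := by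
  have hS : Dfn.{u} 1 (fun M v => (v 0).IsOrdinal ∧ (∃ x ∈ M, x ∈ v 0) ∧
      (∀ x ∈ v 0, ∃ y ∈ v 0, x ∈ y) ∧
        ∀ x ∈ v 0, (∃ y ∈ M, y ∈ x) → ∃ y ∈ x, ∀ z ∈ x, y ∉ z) := by
    repeat' first
      | apply Dfn.isOrdinal | apply Dfn.mem | apply Dfn.and | apply Dfn.ex | apply Dfn.allb
      | apply Dfn.exb | apply Dfn.not | apply Dfn.imp
  have hw := isOmega_omega.{u}
  obtain ⟨h1, ⟨x, -, hx⟩, h3, h4⟩ := (hS.transfer hM e ![Ordinal.omega0.toZFSet]).1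
    ⟨hw.1, let ⟨x, hx⟩ := hw.2.1; ⟨x, trivial, hx⟩, hw.2.2.1,
      fun x hx ⟨y, _, hy⟩ => hw.2.2.2 x hx ⟨y, hy⟩⟩
  have hfix : e.j Ordinal.omega0.toZFSet = Ordinal.omega0.toZFSet :=
    (isOmega_omega.unique ⟨h1, ⟨x, hx⟩, h3, fun x hx ⟨y, hy⟩ =>
      h4 x hx ⟨y, hM _ (hM _ (e.maps _ trivial) _ hx) _ hy, hy⟩⟩).symm
  rcases (ZFSet.isOrdinal_toZFSet Ordinal.omega0.{u}).mem_trichotomous hκ.1 with H | H | H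
  · exact H
  · have := hκ.2.1
    rw [← H, hfix] at this
    exact (ZFSet.mem_irrefl _ this).elim
  · obtain ⟨a, ha, rfl⟩ := Ordinal.mem_toZFSet_iff.1 H
    obtain ⟨n, rfl⟩ := Ordinal.lt_omega0.1 ha
    have := hκ.2.1
    cases n with
    | zero => simp [e.empty hM] at this
    | succ n =>
      push_cast at this hκ
      rw [Ordinal.toZFSet_add_one, e.insert_eq hM, hκ.2.2 _ (ZFSet.isOrdinal_toZFSet _)
        (Ordinal.toZFSet_mem_toZFSet_iff.2 (by simp))] at this
      exact (ZFSet.mem_irrefl _ this).elim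

theorem ClassEmb.pair_mem_target {M : Set ZFSet.{u}} (hM : TransClass M) (e : ClassEmb V M)
    {a b : ZFSet.{u}} (ha : a ∈ M) (hb : b ∈ M) : ZFSet.pair a b ∈ M := by
  have hS : Dfn.{u} 0 (fun M _ => ∀ a ∈ M, ∀ b ∈ M, ∃ p ∈ M, p = ZFSet.pair a b) := by
    repeat' first | apply Dfn.eq_pair _ _ _ | apply Dfn.ex | apply Dfn.all
  obtain ⟨p, hp, rfl⟩ := (hS.transfer hM e ![]).1 (fun a _ b _ => ⟨_, trivial, rfl⟩) a ha b hb
  exact hp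

/-- A class closed under `D`-sequences contains its subsets of size at most that of `D`. -/
theorem mem_of_seqClosed {M : Set ZFSet.{u}} (hM : TransClass M) (e : ClassEmb V M)
    {D : ZFSet.{u}} (hD : SeqClosed D M) {x : ZFSet.{u}} (hx : ∀ y ∈ x, y ∈ M)
    (hc : Cardinal.mk x.toSet ≤ Cardinal.mk D.toSet) : x ∈ M := by
  rcases x.eq_empty_or_nonempty with rfl | ⟨y₀, hy₀⟩
  · rw [← e.empty hM]
    exact e.maps _ trivial
  have hne : Nonempty x.toSet := ⟨⟨y₀, hy₀⟩⟩
  obtain ⟨s, hs⟩ : ∃ s : D.toSet → x.toSet, Function.Surjective s := by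
    obtain ⟨g⟩ := hc
    exact ⟨Function.invFun g, Function.invFun_surjective g.injective⟩
  classical
  let F : ZFSet.{u} → ZFSet.{u} := fun a => if h : a ∈ D then s ⟨a, h⟩ else ∅
  have hF : ∀ a (h : a ∈ D), F a = s ⟨a, h⟩ := fun a h => dif_pos h
  have hG : graph D F ∈ M := by
    refine hD _ ⟨fun p hp => ?_, fun a ha => ⟨F a, pair_mem_graph.2 ⟨ha, rfl⟩, fun b hb =>
      (pair_mem_graph.1 hb).2⟩⟩
    obtain ⟨a, ha, rfl⟩ := mem_graph.1 hp
    exact ⟨a, F a, ha, hx _ (by rw [hF a ha]; exact (s ⟨a, ha⟩).2), rfl⟩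
  have hS : Dfn.{u} 0 (fun M _ => ∀ f ∈ M, ∃ y ∈ M, ∀ z ∈ M,
      (z ∈ y ↔ ∃ a ∈ M, ZFSet.pair a z ∈ f)) := by
    repeat' first
      | apply Dfn.mem | apply Dfn.pair_mem _ _ _ | apply Dfn.iff | apply Dfn.ex | apply Dfn.all
  obtain ⟨y, hyM, hy⟩ := (hS.transfer hM e ![]).1 (fun f _ =>
    ⟨ZFSet.sep (fun z => ∃ a, ZFSet.pair a z ∈ f) (ZFSet.sUnion (ZFSet.sUnion f)), trivial,
      fun z _ => by
        simp only [ZFSet.mem_sep, V, Set.mem_univ, true_and, and_iff_right_iff_imp]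
        rintro ⟨a, ha⟩
        exact ZFSet.mem_sUnion.2 ⟨{a, z}, ZFSet.mem_sUnion.2 ⟨_, ha, by simp [ZFSet.pair]⟩,
          by simp⟩⟩) _ hG
  convert hyM
  ext z
  constructor
  · intro hz
    obtain ⟨⟨a, ha⟩, has⟩ := hs ⟨z, hz⟩
    have ha' : a ∈ D := ha
    exact (hy z (hx z hz)).2 ⟨a, (hM.fst_snd_mem (hM _ hG _ (pair_mem_graph.2 ⟨ha', rfl⟩))).1,
      pair_mem_graph.2 ⟨ha', by rw [hF a ha', has]⟩⟩
  · intro hz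
    obtain ⟨a, -, ha⟩ := (hy z (hM _ hyM _ hz)).1 hz
    obtain ⟨haD, rfl⟩ := pair_mem_graph.1 ha
    rw [hF a haD]
    exact (s ⟨a, haD⟩).2

/-- If `D` is at least as large as every set of rank at most `o`, then classes closed under
`D`-sequences contain these sets. -/
theorem mem_of_rank_le {M : Set ZFSet.{u}} (hM : TransClass M) (e : ClassEmb V M)
    {D : ZFSet.{u}} (hD : SeqClosed D M) {o : Ordinal.{u}}
    (hc : ∀ x : ZFSet.{u}, x.rank ≤ o → Cardinal.mk x.toSet ≤ Cardinal.mk D.toSet)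
    (x : ZFSet.{u}) : x.rank ≤ o → x ∈ M := by
  induction x using ZFSet.inductionOn with
  | _ x ih =>
    exact fun hx => mem_of_seqClosed hM e hD
      (fun y hy => ih y hy ((ZFSet.rank_lt_of_mem hy).le.trans hx)) (hc x hx)

theorem mk_toSet (x : ZFSet.{u}) : Cardinal.mk x.toSet = Cardinal.lift.{u + 1} x.card :=
  ZFSet.cardinalMk_coe_sort

/-- There are arbitrarily large cardinals. -/
theorem exists_isCard (o : Ordinal.{u}) : ∃ D : ZFSet.{u}, IsCard D ∧ o.toZFSet ∈ D ∧
    ∀ x : ZFSet.{u}, x.rank ≤ o → Cardinal.mk x.toSet ≤ Cardinal.mk D.toSet := by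
  refine ⟨(Order.succ (ZFSet.vonNeumann o).card).ord.toZFSet,
    ⟨ZFSet.isOrdinal_toZFSet _, fun b hb => ?_⟩, ?_, fun x hx => ?_⟩
  · obtain ⟨a, ha, rfl⟩ := Ordinal.mem_toZFSet_iff.1 hb
    rw [mk_toSet, mk_toSet, Cardinal.lift_lt, Ordinal.card_toZFSet, Ordinal.card_toZFSet,
      Cardinal.card_ord]
    exact Cardinal.lt_ord.1 ha
  · rw [Ordinal.toZFSet_mem_toZFSet_iff, Cardinal.lt_ord, Order.lt_succ_iff]
    exact Ordinal.card_le_card_vonNeumann o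
  · rw [mk_toSet, mk_toSet, Cardinal.lift_le, Ordinal.card_toZFSet, Cardinal.card_ord]
    exact (ZFSet.card_mono (ZFSet.subset_vonNeumann.2 hx)).trans (Order.le_succ _)

theorem IsCollapse.rank_le {T i : ZFSet.{u}} (h : IsCollapse T i) (a : ZFSet.{u}) :
    ∀ b, ZFSet.pair a b ∈ i → b.rank ≤ a.rank := by
  induction a using ZFSet.inductionOn with
  | _ a ih =>
    intro b hb
    rw [ZFSet.rank_le_iff]
    intro v hv
    obtain ⟨c, hc, hcv⟩ := (h.2 a b hb).1 v hv
    exact (ih c hc v hcv).trans_lt (ZFSet.rank_lt_of_mem hc)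

theorem IsCollapse.fst_mem {T i a b : ZFSet.{u}} (h : IsCollapse T i)
    (hab : ZFSet.pair a b ∈ i) : a ∈ T := by
  obtain ⟨c, d, h, hc⟩ := h.1 _ hab
  obtain ⟨rfl, rfl⟩ := ZFSet.pair_injective h
  exact hc

theorem isSuccLimit_add_omega (o : Ordinal.{u}) : Order.IsSuccLimit (o + Ordinal.omega0) :=
  Ordinal.isSuccLimit_add _ Ordinal.isSuccLimit_omega0

theorem lt_add_omega (o : Ordinal.{u}) : o < o + Ordinal.omega0 :=
  lt_add_of_pos_right _ Ordinal.omega0_pos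

theorem IsCollapse.rank_self_le {T i : ZFSet.{u}} (h : IsCollapse T i) :
    i.rank ≤ T.rank + Ordinal.omega0 := by
  rw [ZFSet.rank_le_iff]
  intro p hp
  obtain ⟨a, b, rfl, ha⟩ := h.1 p hp
  have ha := (ZFSet.rank_lt_of_mem ha).trans (lt_add_omega T.rank)
  exact rank_pair_lt (isSuccLimit_add_omega _) ha ((h.rank_le a b hp).trans_lt ha)

/-- Good ultrafilters in the sense of `M` are good if `M` contains enough sets. -/
theorem Good.of_closed {M : Set ZFSet.{u}} {I U κ f T θ A : ZFSet.{u}}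
    (h : Good M I U κ f T θ A) (hT : T.IsTransitive) (hκ : κ ∈ T)
    (hM : ∀ x : ZFSet.{u}, x.rank ≤ T.rank + Ordinal.omega0 + Ordinal.omega0 → x ∈ M) :
    Good V I U κ f T θ A := by
  obtain ⟨h1, h2, h3, h4, h5, h6, h7, h8, h9, h10⟩ := h
  have hI : ∀ i ∈ I, i.rank < T.rank + Ordinal.omega0 + Ordinal.omega0 := fun i hi =>
    (h1 i hi).rank_self_le.trans_lt (lt_add_omega _)
  have hT' : ∀ b ∈ T, b.rank < T.rank + Ordinal.omega0 + Ordinal.omega0 := fun b hb =>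
    ((ZFSet.rank_lt_of_mem hb).trans (lt_add_omega _)).trans (lt_add_omega _)
  have hg : ∀ g : ZFSet.{u}, ∃ g' ∈ M, ∀ i ∈ I, ∀ b ∈ T, (ZFSet.pair i b ∈ g' ↔ ZFSet.pair i b ∈ g) := by
    intro g
    refine ⟨ZFSet.sep (fun p => ∃ i ∈ I, ∃ b ∈ T, p = ZFSet.pair i b) g, hM _ ?_, ?_⟩
    · rw [ZFSet.rank_le_iff]
      intro p hp
      obtain ⟨-, i, hi, b, hb, rfl⟩ := ZFSet.mem_sep.1 hp
      exact rank_pair_lt (isSuccLimit_add_omega _) (hI i hi) (hT' b hb)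
    · intro i hi b hb
      rw [ZFSet.mem_sep]
      exact ⟨fun h => h.1, fun h => ⟨h, i, hi, b, hb, rfl⟩⟩
  refine ⟨h1, h2, h3, h4, ?_, h6, ?_, ?_, h9, h10⟩
  · exact fun X _ hX => h5 X (hM X (ZFSet.rank_le_iff.2 fun i hi => hI i (hX hi))) hX
  · intro g _ X hX hgX
    obtain ⟨g', hg'M, hg'⟩ := hg g
    obtain ⟨a, ha, Y, hY, H⟩ := h7 g' hg'M X hX fun i hi => by
      obtain ⟨b, c, hbc, hb⟩ := hgX i hi
      exact ⟨b, c, hbc, (hg' i (h2 X hX hi) b ((h1 i (h2 X hX hi)).fst_mem hbc)).2 hb⟩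
    exact ⟨a, ha, Y, hY, fun i hi => (hg' i (h2 Y hY hi) a ha).1 (H i hi)⟩
  · intro α hα g _ X hX hgX
    have hαT : ∀ b ∈ α, b ∈ T := fun b hb =>
      hT.subset_of_mem (hT.subset_of_mem hκ hα) hb
    obtain ⟨g', hg'M, hg'⟩ := hg g
    obtain ⟨a, ha, Y, hY, H⟩ := h8 α hα g' hg'M X hX fun i hi => by
      obtain ⟨b, hbα, hb⟩ := hgX i hi
      exact ⟨b, hbα, (hg' i (h2 X hX hi) b (hαT b hbα)).2 hb⟩
    exact ⟨a, ha, Y, hY, fun i hi => (hg' i (h2 Y hY hi) a (hαT a ha)).1 (H i hi)⟩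

theorem Good.relativize {M : Set ZFSet.{u}} {I U κ f T θ A : ZFSet.{u}}
    (h : Good V I U κ f T θ A) : Good M I U κ f T θ A := by
  obtain ⟨h1, h2, h3, h4, h5, h6, h7, h8, h9, h10⟩ := h
  exact ⟨h1, h2, h3, h4, fun X _ => h5 X trivial, h6, fun g _ => h7 g trivial,
    fun α hα g _ => h8 α hα g trivial, h9, h10⟩

theorem ClassEmb.mem_j_sep {M : Set ZFSet.{u}} (hM : TransClass M) (e : ClassEmb V M)
    {R : ZFSet.{u} → ZFSet.{u} → ZFSet.{u} → ZFSet.{u} → Prop}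
    (hR : ∀ {n : ℕ} (a b c d : Fin n), Dfn n fun _ v => R (v a) (v b) (v c) (v d))
    {I S : ZFSet.{u}} (p q s : ZFSet.{u}) (hS : S ∈ e.j I) :
    S ∈ e.j (ZFSet.sep (fun i => R i p q s) I) ↔ R S (e.j p) (e.j q) (e.j s) := by
  have hD : Dfn.{u} 5 (fun M v => ∀ i ∈ v 0, (i ∈ v 1 ↔ R i (v 2) (v 3) (v 4))) := by
    repeat' first | apply hR | apply Dfn.mem | apply Dfn.iff | apply Dfn.allb
  exact (hD.transfer hM e ![I, ZFSet.sep (fun i => R i p q s) I, p, q, s]).1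
    (fun i hi => (ZFSet.mem_sep (p := fun i => R i p q s) (x := I)).trans
      (and_iff_right hi)) S hS

/-- An elementary embedding gives rise to a good ultrafilter. -/
theorem exists_good {M : Set ZFSet.{u}} (hM : TransClass M) (e : ClassEmb V M)
    {κ r T θ A : ZFSet.{u}} (hκ : CritPt e.j κ) (hT : T.IsTransitive) (hκT : κ ∈ T)
    (hθT : θ ∈ T) (hAT : A ∈ T) (hθ : θ ∈ e.j κ) (hA : ZFSet.pair κ A ∈ e.j r)
    {S : ZFSet.{u}} (hSM : S ∈ M) (hS : ∀ p, p ∈ S ↔ ∃ a ∈ T, p = ZFSet.pair (e.j a) a) :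
    ∃ I U : ZFSet.{u}, I.rank ≤ T.rank + Ordinal.omega0 + 1 ∧
      U.rank ≤ T.rank + Ordinal.omega0 + 2 ∧ Good V I U κ r T θ A := by
  have hpS : ∀ a b, ZFSet.pair a b ∈ S ↔ b ∈ T ∧ a = e.j b := by
    intro a b
    rw [hS]
    constructor
    · rintro ⟨c, hc, h⟩
      obtain ⟨rfl, rfl⟩ := ZFSet.pair_injective h
      exact ⟨hc, rfl⟩
    · rintro ⟨h, rfl⟩
      exact ⟨b, h, rfl⟩
  set I := ZFSet.sep (IsCollapse T) (ZFSet.vonNeumann (T.rank + Ordinal.omega0 + 1)) with hI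
  have hmI : ∀ i, i ∈ I ↔ IsCollapse T i := by
    intro i
    rw [hI, ZFSet.mem_sep, ZFSet.mem_vonNeumann, and_iff_right_iff_imp]
    exact fun h => Order.lt_add_one_iff.2 h.rank_self_le
  have hSI : S ∈ e.j I := by
    have hD : Dfn.{u} 2 (fun M v => ∀ i ∈ M, IsCollapse (v 0) i → i ∈ v 1) := by
      repeat' first
        | apply Dfn.isCollapse | apply Dfn.mem | apply Dfn.all | apply Dfn.imp
    refine (hD.transfer hM e ![T, I]).1 (fun i _ hi => (hmI i).2 hi) S hSM ⟨?_, ?_⟩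
    · intro p hp
      obtain ⟨a, ha, rfl⟩ := (hS p).1 hp
      exact ⟨_, _, rfl, (e.mem_iff hM a T).2 ha⟩
    · intro a b hab
      obtain ⟨hb, rfl⟩ := (hpS _ _).1 hab
      refine ⟨fun v hv => ⟨e.j v, (e.mem_iff hM _ _).2 hv,
        (hpS _ _).2 ⟨hT.subset_of_mem hb hv, rfl⟩⟩, ?_⟩
      intro c v hcv hc
      obtain ⟨hv, rfl⟩ := (hpS _ _).1 hcv
      exact (e.mem_iff hM _ _).1 hc
  set U := ZFSet.sep (fun X => S ∈ e.j X) (ZFSet.powerset I) with hU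
  have hmU : ∀ X, X ∈ U ↔ X ⊆ I ∧ S ∈ e.j X := by
    intro X
    rw [hU, ZFSet.mem_sep, ZFSet.mem_powerset]
  have sepU : ∀ {R : ZFSet.{u} → ZFSet.{u} → ZFSet.{u} → ZFSet.{u} → Prop}
      (_ : ∀ {n : ℕ} (a b c d : Fin n), Dfn n fun _ v => R (v a) (v b) (v c) (v d))
      (p q s : ZFSet.{u}), R S (e.j p) (e.j q) (e.j s) →
      ∃ X ∈ U, ∀ i ∈ X, R i p q s := by
    intro R hR p q s h
    exact ⟨ZFSet.sep (fun i => R i p q s) I, (hmU _).2 ⟨fun i hi => (ZFSet.mem_sep.1 hi).1,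
      (e.mem_j_sep hM hR p q s hSI).2 h⟩, fun i hi => (ZFSet.mem_sep.1 hi).2⟩
  have hIr : I.rank ≤ T.rank + Ordinal.omega0 + 1 := by
    rw [← ZFSet.rank_vonNeumann (T.rank + Ordinal.omega0 + 1)]
    exact ZFSet.rank_mono fun i hi => (ZFSet.mem_sep.1 hi).1
  refine ⟨I, U, hIr, ?_, fun i hi => (hmI i).1 hi, fun X hX => ((hmU X).1 hX).1, ?_, ?_, ?_, ?_,
    ?_, ?_, ?_, ?_⟩
  · calc U.rank ≤ (ZFSet.powerset I).rank :=
          ZFSet.rank_mono fun i hi => (ZFSet.mem_sep.1 hi).1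
      _ = I.rank + 1 := by rw [ZFSet.rank_powerset, Order.succ_eq_add_one]
      _ ≤ T.rank + Ordinal.omega0 + 1 + 1 := by gcongr
      _ = _ := by rw [add_assoc _ 1 1, one_add_one_eq_two]
  · intro X hX
    obtain ⟨hXI, hSX⟩ := (hmU X).1 hX
    rcases X.eq_empty_or_nonempty with rfl | ⟨y, hy⟩
    · simp [e.empty hM] at hSX
    · exact ⟨y, hXI hy, hy⟩
  · intro X hX Y hY
    obtain ⟨Z, hZ, h⟩ := sepU (R := fun i p q _ => i ∈ p ∧ i ∈ q)
      (fun _ _ _ _ => (Dfn.mem _ _).and (Dfn.mem _ _)) X Y ∅ ⟨((hmU X).1 hX).2, ((hmU Y).1 hY).2⟩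
    exact ⟨Z, hZ, fun i hi => (h i hi).1, fun i hi => (h i hi).2⟩
  · intro X _ hX
    by_cases hSX : S ∈ e.j X
    · exact ⟨X, (hmU X).2 ⟨hX, hSX⟩, Or.inl fun _ h => h⟩
    · obtain ⟨Y, hY, h⟩ := sepU (R := fun i p _ _ => i ∉ p)
        (fun _ _ _ _ => (Dfn.mem _ _).not) X ∅ ∅ hSX
      exact ⟨Y, hY, Or.inr h⟩
  · intro a ha
    refine sepU (R := fun i a _ _ => ∃ p ∈ i, ∃ c b, p = ZFSet.pair c b ∧ c = a) ?_ a ∅ ∅ ?_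
    · intro n _ _ _ _
      repeat' first | apply Dfn.eq | apply Dfn.exb | apply Dfn.ex_eq_pair
    · exact ⟨_, (hpS _ _).2 ⟨ha, rfl⟩, _, _, rfl, rfl⟩
  · intro g _ X hX H
    have hD : Dfn.{u} 2 (fun M v => ∀ i ∈ v 0, ∃ b c, ZFSet.pair b c ∈ i ∧
        ZFSet.pair i b ∈ v 1) := by
      repeat' first | apply Dfn.pair_mem | apply Dfn.ex_pair | apply Dfn.allb
    obtain ⟨b, c, hbc, hb⟩ := (hD.transfer hM e ![X, g]).1 H S ((hmU X).1 hX).2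
    obtain ⟨hc, rfl⟩ := (hpS _ _).1 hbc
    exact ⟨c, hc, sepU (R := fun i a g _ => ZFSet.pair i a ∈ g)
      (fun _ _ _ _ => Dfn.pair_mem _ _ _) c g ∅ hb⟩
  · intro α hα g _ X hX H
    have hD : Dfn.{u} 3 (fun M v => ∀ i ∈ v 0, ∃ b ∈ v 2, ZFSet.pair i b ∈ v 1) := by
      repeat' first | apply Dfn.pair_mem | apply Dfn.exb | apply Dfn.allb
    obtain ⟨b, hb, hb'⟩ := (hD.transfer hM e ![X, g, α]).1 H S ((hmU X).1 hX).2
    change b ∈ e.j α at hb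
    rw [hκ.2.2 α (hκ.1.mem hα) hα] at hb
    refine ⟨b, hb, sepU (R := fun i a g _ => ZFSet.pair i a ∈ g)
      (fun _ _ _ _ => Dfn.pair_mem _ _ _) b g ∅ ?_⟩
    have hbκ := hκ.1.mem_trans hb hα
    rwa [hκ.2.2 b (hκ.1.mem hbκ) hbκ]
  · refine sepU (R := fun i κ θ _ => ∃ t ∈ κ, ZFSet.pair θ t ∈ i) ?_ κ θ ∅ ?_
    · intro n _ _ _ _
      repeat' first | apply Dfn.pair_mem | apply Dfn.exb
    · exact ⟨θ, hθ, (hpS _ _).2 ⟨hθT, rfl⟩⟩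
  · refine sepU (R := fun i f κ A => ∃ k a, ZFSet.pair k a ∈ f ∧ ZFSet.pair κ k ∈ i ∧
      ZFSet.pair A a ∈ i) ?_ r κ A ?_
    · intro n _ _ _ _
      repeat' first | apply Dfn.pair_mem | apply Dfn.and | apply Dfn.ex_pair
    · exact ⟨κ, A, hA, (hpS _ _).2 ⟨hκT, rfl⟩, (hpS _ _).2 ⟨hAT, rfl⟩⟩

section Ultrapower

open Filter

variable {ι : Type (u + 1)} (W : Ultrafilter ι)

/-- Membership in the ultrapower of the universe. -/
def UltMem (h g : ι → ZFSet.{u}) : Prop := ∀ᶠ i in W, h i ∈ g i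

variable {W}

theorem ultMem_wellFounded (hW : ∀ n : ι → ℕ, ∃ k, ∀ᶠ i in W, n i = k) :
    WellFounded (UltMem.{u} W) := by
  rw [wellFounded_iff_isEmpty_descending_chain]
  refine ⟨fun ⟨f, hf⟩ => ?_⟩
  have hn : ∀ i, ∃ n, f (n + 1) i ∉ f n i := by
    intro i
    by_contra! h
    exact (wellFounded_iff_isEmpty_descending_chain.1 ZFSet.mem_wf).false ⟨fun n => f n i, h⟩
  choose n hn using hn
  obtain ⟨k, hk⟩ := hW n
  obtain ⟨i, hi, hi'⟩ := (hk.and (hf k)).exists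
  exact hn i (hi ▸ hi')

theorem exists_trim {h g : ι → ZFSet.{u}} (hg : UltMem W h g) :
    ∃ h' : ∀ i, (insert ∅ (g i) : ZFSet.{u}), UltMem W (fun i => (h' i).1) g ∧
      ∀ᶠ i in W, h i = (h' i).1 := by
  classical
  refine ⟨fun i => if H : h i ∈ g i then ⟨h i, by simp [H]⟩ else ⟨∅, by simp⟩, ?_, ?_⟩
  · filter_upwards [hg] with i hi
    simp [hi]
  · filter_upwards [hg] with i hi
    simp [hi]

variable [Small.{u} ι]

/-- The transitive collapse of the ultrapower of the universe. -/
noncomputable def ultCollapse (hwf : WellFounded (UltMem.{u} W)) :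
    (ι → ZFSet.{u}) → ZFSet.{u} :=
  hwf.fix fun g ih => ZFSet.range
    fun h : {h : ∀ i, (insert ∅ (g i) : ZFSet.{u}) // UltMem W (fun i => (h i).1) g} =>
      ih (fun i => (h.1 i).1) h.2

variable (hwf : WellFounded (UltMem.{u} W))

theorem mem_ultCollapse' {g : ι → ZFSet.{u}} {y : ZFSet.{u}} : y ∈ ultCollapse hwf g ↔
    ∃ h : ∀ i, (insert ∅ (g i) : ZFSet.{u}), UltMem W (fun i => (h i).1) g ∧
      ultCollapse hwf (fun i => (h i).1) = y := by
  rw [ultCollapse, WellFounded.fix_eq, ZFSet.mem_range]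
  simp

theorem ultCollapse_congr (g : ι → ZFSet.{u}) : ∀ g', (∀ᶠ i in W, g i = g' i) →
    ultCollapse hwf g = ultCollapse hwf g' := by
  induction g using hwf.induction with
  | _ g ih =>
    intro g' hg
    ext y
    rw [mem_ultCollapse', mem_ultCollapse']
    constructor
    · rintro ⟨h, hh, rfl⟩
      have hh' : UltMem W (fun i => (h i).1) g' := by
        filter_upwards [hh, hg] with i h1 h2
        rwa [← h2]
      obtain ⟨k, hk, hhk⟩ := exists_trim hh'
      exact ⟨k, hk, (ih _ hh _ hhk).symm⟩
    · rintro ⟨h, hh, rfl⟩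
      have hh' : UltMem W (fun i => (h i).1) g := by
        filter_upwards [hh, hg] with i h1 h2
        rwa [h2]
      obtain ⟨k, hk, hhk⟩ := exists_trim hh'
      exact ⟨k, hk, ih _ hk _ (hhk.mono fun i hi => hi.symm)⟩

theorem mem_ultCollapse {g : ι → ZFSet.{u}} {y : ZFSet.{u}} : y ∈ ultCollapse hwf g ↔
    ∃ h, UltMem W h g ∧ ultCollapse hwf h = y := by
  rw [mem_ultCollapse']
  constructor
  · rintro ⟨h, hh, rfl⟩
    exact ⟨_, hh, rfl⟩
  · rintro ⟨h, hh, rfl⟩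
    obtain ⟨k, hk, hhk⟩ := exists_trim hh
    exact ⟨k, hk, (ultCollapse_congr hwf _ _ hhk).symm⟩

theorem ultCollapse_eq_iff (g : ι → ZFSet.{u}) : ∀ {g'},
    ultCollapse hwf g = ultCollapse hwf g' ↔ ∀ᶠ i in W, g i = g' i := by
  induction g using hwf.induction with
  | _ g ih =>
    intro g'
    refine ⟨fun H => ?_, ultCollapse_congr hwf g g'⟩
    by_contra hne
    rw [← Ultrafilter.eventually_not] at hne
    have hor : ∀ i, ¬ g i = g' i → ∃ x, (x ∈ g i ∧ x ∉ g' i) ∨ (x ∈ g' i ∧ x ∉ g i) := by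
      intro i hi
      by_contra! h
      exact hi (ZFSet.ext fun x => ⟨(h x).1, (h x).2⟩)
    choose! x hx using hor
    rcases Ultrafilter.eventually_or.1 (hne.mono hx) with h | h
    · have h1 : UltMem W x g := h.mono fun i hi => hi.1
      obtain ⟨k, hk, hkx⟩ := (mem_ultCollapse hwf).1
        (H ▸ (mem_ultCollapse hwf).2 ⟨x, h1, rfl⟩ : _ ∈ ultCollapse hwf g')
      obtain ⟨i, ⟨hi, hi'⟩, hi''⟩ := ((h.and hk).and ((ih x h1).1 hkx.symm)).exists
      exact hi.2 (hi''.symm ▸ hi')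
    · have h1 : UltMem W x g' := h.mono fun i hi => hi.1
      obtain ⟨k, hk, hkx⟩ := (mem_ultCollapse hwf).1
        (H ▸ (mem_ultCollapse hwf).2 ⟨x, h1, rfl⟩ : _ ∈ ultCollapse hwf g)
      obtain ⟨i, ⟨hi, hi'⟩, hi''⟩ := ((h.and hk).and ((ih k hk).1 hkx)).exists
      exact hi.2 (hi'' ▸ hi')

theorem ultCollapse_mem_iff {h g : ι → ZFSet.{u}} :
    ultCollapse hwf h ∈ ultCollapse hwf g ↔ ∀ᶠ i in W, h i ∈ g i := by
  rw [mem_ultCollapse]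
  constructor
  · rintro ⟨k, hk, H⟩
    filter_upwards [hk, (ultCollapse_eq_iff hwf k).1 H] with i h1 h2
    rwa [← h2]
  · exact fun H => ⟨h, H, rfl⟩

theorem transClass_range_ultCollapse : TransClass (Set.range (ultCollapse hwf)) := by
  rintro _ ⟨g, rfl⟩ y hy
  obtain ⟨h, -, rfl⟩ := (mem_ultCollapse hwf).1 hy
  exact ⟨h, rfl⟩

/-- The ultrapower is isomorphic to its transitive collapse. -/
noncomputable def ultEquiv :
    SetLang.Equiv ((W : Filter ι).Product fun _ => (V.{u} : Set ZFSet.{u}))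
      (Set.range (ultCollapse hwf)) where
  toEquiv := Equiv.ofBijective
    (Quotient.lift (fun g => ⟨ultCollapse hwf fun i => (g i).1, _, rfl⟩) fun g h hgh =>
      Subtype.ext (ultCollapse_congr hwf _ _ (Filter.Eventually.mono hgh fun i hi => by rw [hi])))
    (by
      constructor
      · intro g h
        induction g using Quotient.inductionOn
        induction h using Quotient.inductionOn
        intro H
        refine Quotient.sound ?_
        exact ((ultCollapse_eq_iff hwf _).1 (Subtype.ext_iff.1 H)).mono
          fun i hi => Subtype.ext hi
      · rintro ⟨_, g, rfl⟩
        exact ⟨Quotient.mk _ fun i => ⟨g i, trivial⟩, rfl⟩)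
  map_fun' f := f.elim
  map_rel' {n} r x := by
    cases r
    obtain ⟨y, rfl⟩ : ∃ y : Fin 2 → ι → (V.{u} : Set ZFSet.{u}), x = fun k => Quotient.mk _ (y k) :=
      ⟨fun k => (x k).out, funext fun k => (Quotient.out_eq _).symm⟩
    refine (ultCollapse_mem_iff hwf (h := fun i => (y 0 i).1) (g := fun i => (y 1 i).1)).trans ?_
    exact (Language.relMap_quotient_mk' ((W : Filter ι).productSetoid _) memSymb y).symm

theorem ult_los {n : ℕ} (φ : SetLang.Formula (Fin n)) (v : Fin n → ι → ZFSet.{u}) :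
    φ.Realize (fun k => (⟨ultCollapse hwf (v k), _, rfl⟩ : Set.range (ultCollapse hwf))) ↔
      ∀ᶠ i in W, φ.Realize (fun k => (⟨v k i, trivial⟩ : (V.{u} : Set ZFSet.{u}))) := by
  have : Nonempty (V.{u} : Set ZFSet.{u}) := ⟨⟨∅, trivial⟩⟩
  rw [← Language.Ultraproduct.realize_formula_cast (u := W) (M := fun _ => (V.{u} : Set ZFSet.{u}))
    φ (fun k i => ⟨v k i, trivial⟩)]
  exact Language.StrongHomClass.realize_formula (ultEquiv hwf) φ
    (v := fun k => Quotient.mk ((W : Filter ι).productSetoid _) fun i => (⟨v k i, trivial⟩ : (V.{u} : Set ZFSet.{u})))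

theorem Dfn.los {n : ℕ} {R : Set ZFSet.{u} → (Fin n → ZFSet.{u}) → Prop} (h : Dfn n R)
    (v : Fin n → ι → ZFSet.{u}) :
    R (Set.range (ultCollapse hwf)) (fun k => ultCollapse hwf (v k)) ↔
      ∀ᶠ i in W, R V (fun k => v k i) := by
  obtain ⟨φ, h⟩ := h
  refine ((h _ (transClass_range_ultCollapse hwf) fun k => ⟨_, _, rfl⟩).symm.trans
    (ult_los hwf φ v)).trans ?_
  exact eventually_congr (.of_forall fun i => h V (fun _ _ _ _ => trivial) _)

/-- The ultrapower embedding. -/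
noncomputable def ultEmb : ClassEmb V.{u} (Set.range (ultCollapse hwf)) where
  j x := ultCollapse hwf fun _ => x
  maps x _ := ⟨_, rfl⟩
  elem φ v _ := by
    refine Iff.symm ((ult_los hwf φ fun k _ => v k).trans ?_)
    exact eventually_const

end Ultrapower

section

open Filter

theorem IsCollapse.functional {T i a b b' : ZFSet.{u}} (h : IsCollapse T i)
    (hb : ZFSet.pair a b ∈ i) (hb' : ZFSet.pair a b' ∈ i) : b = b' := by
  ext v
  constructor
  · intro hv
    obtain ⟨c, hc, hcv⟩ := (h.2 a b hb).1 v hv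
    exact (h.2 a b' hb').2 c v hcv hc
  · intro hv
    obtain ⟨c, hc, hcv⟩ := (h.2 a b' hb').1 v hv
    exact (h.2 a b hb).2 c v hcv hc

/-- The value of the relation `i` at `a`. -/
noncomputable def relVal (i a : ZFSet.{u}) : ZFSet.{u} :=
  Classical.epsilon fun b => ZFSet.pair a b ∈ i

theorem IsCollapse.relVal_eq {T i a b : ZFSet.{u}} (h : IsCollapse T i)
    (hb : ZFSet.pair a b ∈ i) : relVal i a = b :=
  h.functional (Classical.epsilon_spec (p := fun b => ZFSet.pair a b ∈ i) ⟨b, hb⟩) hb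

/-- The ultrafilter generated by a good family. -/
theorem Good.exists_ultrafilter {I U κ f T θ A : ZFSet.{u}} (h : Good V I U κ f T θ A) :
    ∃ W : Ultrafilter I, ∀ P : ZFSet.{u} → Prop,
      (∀ᶠ i : I in W, P i) ↔ ∃ X ∈ U, ∀ i ∈ X, P i := by
  obtain ⟨h1, h2, h3, h4, h5, -⟩ := h
  obtain ⟨X₀, hX₀, -⟩ := h5 ∅ trivial (by simp)
  let F : Filter I :=
    { sets := {s | ∃ X ∈ U, ∀ i : I, i.1 ∈ X → i ∈ s}
      univ_sets := ⟨X₀, hX₀, fun _ _ => trivial⟩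
      sets_of_superset := fun {s t} ⟨X, hX, H⟩ hst => ⟨X, hX, fun i hi => hst (H i hi)⟩
      inter_sets := fun {s t} ⟨X, hX, H⟩ ⟨Y, hY, H'⟩ => by
        obtain ⟨Z, hZ, hZX, hZY⟩ := h4 X hX Y hY
        exact ⟨Z, hZ, fun i hi => ⟨H i (hZX hi), H' i (hZY hi)⟩⟩ }
  have hF : ∀ s, s ∈ F ↔ ∃ X ∈ U, ∀ i : I, i.1 ∈ X → i ∈ s := fun s => Iff.rfl
  refine ⟨Ultrafilter.ofComplNotMemIff F fun s => ⟨fun hs => ?_, fun hs hs' => ?_⟩, fun P => ?_⟩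
  · obtain ⟨Y, hY, H⟩ := h5 (ZFSet.sep (fun i => ∃ h : i ∈ I, (⟨i, h⟩ : I) ∈ s) I) trivial
      fun i hi => (ZFSet.mem_sep.1 hi).1
    rcases H with H | H
    · exact ⟨Y, hY, fun i hi => (ZFSet.mem_sep.1 (H hi)).2.2⟩
    · exact (hs ⟨Y, hY, fun i hi hi' => H i hi (ZFSet.mem_sep.2 ⟨i.2, i.2, hi'⟩)⟩).elim
  · obtain ⟨X, hX, H⟩ := F.inter_sets hs hs'
    obtain ⟨i, hiI, hi⟩ := h3 X hX
    exact (H ⟨i, hiI⟩ hi).2 (H ⟨i, hiI⟩ hi).1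
  · refine (hF {i | P i.1}).trans ?_
    exact exists_congr fun X => and_congr_right fun hX =>
      ⟨fun H i hi => H ⟨i, h2 X hX hi⟩ hi, fun H i hi => H i.1 hi⟩

/-- The ultrapower by a good ultrafilter gives a supercompactness embedding. -/
theorem Good.exists_scEmb {I U κ f T θ A : ZFSet.{u}} (h : Good V I U κ f T θ A)
    (hκ : κ.IsOrdinal) (hω : Ordinal.omega0.toZFSet ∈ κ) (hT : T.IsTransitive) (hκT : κ ∈ T)
    (hθT : θ ∈ T) (hAT : A ∈ T) (hκθ : κ ∈ θ) {D : ZFSet.{u}} (hD : D ∈ θ) :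
    ∃ E : SCEmb κ D, ZFSet.pair κ A ∈ E.e.j f := by
  obtain ⟨W, hW⟩ := h.exists_ultrafilter
  obtain ⟨h1, h2, h3, h4, h5, h6, h7, h8, h9, h10⟩ := h
  have complete : ∀ α ∈ κ, ∀ G : I → ZFSet.{u}, (∀ᶠ i in W, G i ∈ α) →
      ∃ b ∈ α, ∀ᶠ i in W, G i = b := by
    intro α hα G hG
    classical
    let G' : ZFSet.{u} → ZFSet.{u} := fun i => if h : i ∈ I then G ⟨i, h⟩ else ∅
    have hG' : ∀ i : I, G' i = G i := fun i => dif_pos i.2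
    simp only [← hG'] at hG ⊢
    obtain ⟨X, hX, H⟩ := (hW fun i => G' i ∈ α).1 hG
    obtain ⟨b, hb, Y, hY, H⟩ := h8 α hα (graph I G') trivial X hX fun i hi =>
      ⟨_, H i hi, pair_mem_graph.2 ⟨h2 X hX hi, rfl⟩⟩
    exact ⟨b, hb, (hW fun i => G' i = b).2 ⟨Y, hY, fun i hi => (pair_mem_graph.1 (H i hi)).2.symm⟩⟩
  have normal : ∀ G : I → ZFSet.{u}, (∀ᶠ i : I in W, ∃ c, ZFSet.pair (G i) c ∈ i.1) →
      ∃ a ∈ T, ∀ᶠ i in W, G i = a := by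
    intro G hG
    classical
    let G' : ZFSet.{u} → ZFSet.{u} := fun i => if h : i ∈ I then G ⟨i, h⟩ else ∅
    have hG' : ∀ i : I, G' i = G i := fun i => dif_pos i.2
    simp only [← hG'] at hG ⊢
    obtain ⟨X, hX, H⟩ := (hW fun i => ∃ c, ZFSet.pair (G' i) c ∈ i).1 hG
    obtain ⟨b, hb, Y, hY, H⟩ := h7 (graph I G') trivial X hX fun i hi =>
      let ⟨c, hc⟩ := H i hi
      ⟨_, c, hc, pair_mem_graph.2 ⟨h2 X hX hi, rfl⟩⟩
    exact ⟨b, hb, (hW fun i => G' i = b).2 ⟨Y, hY, fun i hi => (pair_mem_graph.1 (H i hi)).2.symm⟩⟩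
  have fine : ∀ a ∈ T, ∀ᶠ i : I in W, ZFSet.pair a (relVal i a) ∈ i.1 := by
    intro a ha
    obtain ⟨X, hX, H⟩ := h6 a ha
    have := (hW fun i => ∃ p ∈ i, ∃ c b, p = ZFSet.pair c b ∧ c = a).2 ⟨X, hX, H⟩
    filter_upwards [this] with i hi
    obtain ⟨_, hp, _, b, rfl, rfl⟩ := hi
    rwa [(h1 i i.2).relVal_eq hp]
  have hwf : WellFounded (UltMem.{u} W) := by
    refine ultMem_wellFounded fun n => ?_
    obtain ⟨b, hb, H⟩ := complete _ hω (fun i => (n i : Ordinal).toZFSet) (.of_forall fun i =>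
      Ordinal.toZFSet_mem_toZFSet_iff.2 (Ordinal.natCast_lt_omega0 _))
    obtain ⟨a, ha, rfl⟩ := Ordinal.mem_toZFSet_iff.1 hb
    obtain ⟨k, rfl⟩ := Ordinal.lt_omega0.1 ha
    exact ⟨k, H.mono fun i hi => by simpa using Ordinal.toZFSet_injective hi⟩
  have hN := transClass_range_ultCollapse hwf
  have represent : ∀ a, a ∈ T → ultCollapse hwf (fun i => relVal i a) = a := by
    intro a
    induction a using ZFSet.inductionOn with
    | _ a ih =>
      intro ha
      ext y
      rw [mem_ultCollapse]
      constructor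
      · rintro ⟨g, hg, rfl⟩
        have hc : ∀ i : I, ∃ c, (g i ∈ relVal i a ∧ ZFSet.pair a (relVal i a) ∈ i.1) →
            c ∈ a ∧ ZFSet.pair c (g i) ∈ i.1 := by
          intro i
          by_cases H : g i ∈ relVal i a ∧ ZFSet.pair a (relVal i a) ∈ i.1
          · obtain ⟨c, hc⟩ := ((h1 i i.2).2 _ _ H.2).1 _ H.1
            exact ⟨c, fun _ => hc⟩
          · exact ⟨∅, fun H' => (H H').elim⟩
        choose c hc using hc
        have hc' := (hg.and (fine a ha)).mono hc
        obtain ⟨b, hb, H⟩ := normal c (hc'.mono fun i hi => ⟨_, hi.2⟩)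
        obtain ⟨i, hi, rfl⟩ := (hc'.and H).exists
        rw [ultCollapse_congr hwf g (fun j => relVal j (c i)), ih _ hi.1 hb]
        · exact hi.1
        · filter_upwards [hc', H] with j hj hj'
          rw [← hj', (h1 j j.2).relVal_eq hj.2]
      · intro hy
        have hyT := hT.subset_of_mem ha hy
        refine ⟨_, ?_, ih y hy hyT⟩
        filter_upwards [fine a ha, fine y hyT] with i hi hi'
        exact ((h1 i i.2).2 _ _ hi).2 _ _ hi' hy
  have hpair : ∀ x y : I → ZFSet.{u}, ultCollapse hwf (fun i => ZFSet.pair (x i) (y i)) =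
      ZFSet.pair (ultCollapse hwf x) (ultCollapse hwf y) := fun x y =>
    ((Dfn.eq_pair 0 1 2).los hwf ![fun i => ZFSet.pair (x i) (y i), x, y]).2
      (.of_forall fun i => rfl)
  have hj : ∀ x, (ultEmb hwf).j x = ultCollapse hwf fun _ => x := fun x => rfl
  have hfix : ∀ α, α ∈ κ → (ultEmb hwf).j α = α := by
    intro α
    induction α using ZFSet.inductionOn with
    | _ α ih =>
      intro hα
      ext y
      rw [hj, mem_ultCollapse]
      constructor
      · rintro ⟨g, hg, rfl⟩
        obtain ⟨b, hb, H⟩ := complete α hα g hg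
        rw [ultCollapse_congr hwf g _ H, ← hj, ih b hb (hκ.mem_trans hb hα)]
        exact hb
      · intro hy
        exact ⟨fun _ => y, .of_forall fun _ => hy, ih y hy (hκ.mem_trans hy hα)⟩
  have hθj : θ ∈ (ultEmb hwf).j κ := by
    rw [← represent θ hθT, hj, ultCollapse_mem_iff]
    refine ((hW _).2 h9).mono fun i => ?_
    rintro ⟨t, ht, hti⟩
    rwa [(h1 i i.2).relVal_eq hti]
  have hjκ : ((ultEmb hwf).j κ).IsOrdinal := ((ultEmb hwf).isOrdinal_iff hN κ).2 hκ
  refine ⟨⟨_, hN, ultEmb hwf, ⟨hκ, hjκ.mem_trans hκθ hθj, fun α _ => hfix α⟩, ?_,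
    hjκ.mem_trans hD hθj⟩, ?_⟩
  · intro s hs
    have hDT : ∀ a ∈ D, a ∈ T := fun a ha =>
      hT.subset_of_mem (hT.subset_of_mem hθT hD) ha
    have hg : ∀ a, ∃ g : I → ZFSet.{u}, a ∈ D → ZFSet.pair a (ultCollapse hwf g) ∈ s := by
      intro a
      by_cases ha : a ∈ D
      · obtain ⟨b, hb, -⟩ := hs.2 a ha
        obtain ⟨a', b', -, ⟨g, hg⟩, hab⟩ := hs.1 _ hb
        obtain ⟨rfl, rfl⟩ := ZFSet.pair_injective hab
        exact ⟨g, fun _ => hg ▸ hb⟩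
      · exact ⟨fun _ => ∅, fun h => (ha h).elim⟩
    choose g hg using hg
    let G : I → ZFSet.{u} := fun i => ZFSet.range
      fun a : ZFSet.sep (fun a => ZFSet.pair a (relVal i a) ∈ i.1) D =>
        ZFSet.pair (relVal i a) (g a i)
    have hG : ∀ i p, p ∈ G i ↔ ∃ a ∈ D, ZFSet.pair a (relVal i a) ∈ i.1 ∧
        p = ZFSet.pair (relVal i a) (g a i) := by
      intro i p
      simp only [G, ZFSet.mem_range, Subtype.exists, ZFSet.mem_sep, exists_prop, and_assoc,
        eq_comm]
    refine ⟨G, ?_⟩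
    ext y
    rw [mem_ultCollapse]
    constructor
    · rintro ⟨k, hk, rfl⟩
      have hc : ∀ i : I, ∃ c, k i ∈ G i → c ∈ D ∧ ZFSet.pair c (relVal i c) ∈ i.1 ∧
          k i = ZFSet.pair (relVal i c) (g c i) := by
        intro i
        by_cases H : k i ∈ G i
        · obtain ⟨c, hc⟩ := (hG i _).1 H
          exact ⟨c, fun _ => hc⟩
        · exact ⟨∅, fun H' => (H H').elim⟩
      choose c hc using hc
      have hc' := hk.mono hc
      obtain ⟨a, ha, H⟩ := normal c (hc'.mono fun i hi => ⟨_, hi.2.1⟩)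
      obtain ⟨i, hi, hia⟩ := (hc'.and H).exists
      rw [hia] at hi
      rw [ultCollapse_congr hwf k (fun i => ZFSet.pair (relVal i a) (g a i)), hpair,
        represent a ha]
      · exact hg a hi.1
      · filter_upwards [hc', H] with j hj hj'
        rw [hj.2.2, hj']
    · intro hy
      obtain ⟨a, b, ha, -, rfl⟩ := hs.1 y hy
      obtain rfl := (hs.2 a ha).unique hy (hg a ha)
      refine ⟨fun i => ZFSet.pair (relVal i a) (g a i), ?_, ?_⟩
      · filter_upwards [fine a (hDT a ha)] with i hi
        exact (hG i _).2 ⟨a, ha, hi, rfl⟩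
      · rw [hpair, represent a (hDT a ha)]
  · change ZFSet.pair κ A ∈ (ultEmb hwf).j f
    have hp : ultCollapse hwf (fun i : I => ZFSet.pair (relVal i κ) (relVal i A)) =
        ZFSet.pair κ A := by rw [hpair, represent κ hκT, represent A hAT]
    rw [← hp, hj, ultCollapse_mem_iff]
    refine ((hW _).2 h10).mono fun i => ?_
    rintro ⟨k, a, hka, hk, ha⟩
    rwa [(h1 i i.2).relVal_eq hk, (h1 i i.2).relVal_eq ha]

end

theorem exists_minCounterEx {γ f : ZFSet.{u}} (h : ∃ η ∈ V, HasCounterEx V γ f η) :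
    ∃ A, MinCounterEx V γ f A := by
  obtain ⟨η, -, hη⟩ := h
  obtain ⟨η, ⟨T, -, θ, -, A, -, hC⟩, hmin⟩ :=
    ZFSet.mem_wf.has_min {η | HasCounterEx V γ f η} ⟨η, hη⟩
  exact ⟨A, η, trivial, ⟨T, trivial, θ, trivial, hC⟩, fun ξ _ hξ => hmin ξ hξ⟩

open Classical in
/-- The class function obtained by recursively choosing minimal counterexamples. -/
noncomputable def menas : ZFSet.{u} → ZFSet.{u} :=
  ZFSet.mem_wf.fix fun γ F =>
    let f := graph γ fun δ => if h : δ ∈ γ then F δ h else ∅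
    if ∃ A, MinCounterEx V γ f A then Classical.epsilon fun A => MinCounterEx V γ f A else ∅

open Classical in
theorem menas_eq (γ : ZFSet.{u}) : menas γ =
    if ∃ A, MinCounterEx V γ (graph γ menas) A then
      Classical.epsilon fun A => MinCounterEx V γ (graph γ menas) A else ∅ := by
  have hg : (graph γ fun δ => if _h : δ ∈ γ then menas δ else ∅) = graph γ menas := by
    ext p
    rw [mem_graph, mem_graph]
    refine exists_congr fun a => and_congr_right fun ha => ?_
    rw [dif_pos ha]
  rw [menas, WellFounded.fix_eq, ← menas]
  simp only [hg]

theorem minCounterEx_menas {γ A : ZFSet.{u}} (h : MinCounterEx V γ (graph γ menas) A) :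
    MinCounterEx V γ (graph γ menas) (menas γ) := by
  rw [menas_eq, if_pos ⟨A, h⟩]
  exact Classical.epsilon_spec ⟨A, h⟩

theorem menas_eq_empty {γ : ZFSet.{u}} (h : ¬ ∃ A, MinCounterEx V γ (graph γ menas) A) :
    menas γ = ∅ := by
  rw [menas_eq, if_neg h]

theorem isMenas_graph {κ : ZFSet.{u}} (hκ : κ.IsOrdinal) : IsMenas V (graph κ menas) := by
  intro γ A hA f _ hf hex
  obtain ⟨hγ, rfl⟩ := pair_mem_graph.1 hA
  obtain rfl : f = graph γ menas := by
    ext p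
    rw [mem_graph]
    constructor
    · intro hp
      obtain ⟨hp', δ, A, rfl, hδ⟩ := hf.1 p hp
      exact ⟨δ, hδ, by rw [(pair_mem_graph.1 hp').2]⟩
    · rintro ⟨δ, hδ, rfl⟩
      exact hf.2 _ _ (pair_mem_graph.2 ⟨hκ.mem_trans hδ hγ, rfl⟩) hδ
  exact minCounterEx_menas (exists_minCounterEx hex).choose_spec

theorem CounterEx.isRanking {M : Set ZFSet.{u}} {γ f η T θ A : ZFSet.{u}}
    (h : CounterEx M γ f η T θ A) : ∃ ρ, IsRanking ρ T η :=
  let ⟨ρ, _, hρ⟩ := h.2.1; ⟨ρ, hρ⟩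

theorem CounterEx.rank_lt {M : Set ZFSet.{u}} {γ f η T θ A x : ZFSet.{u}}
    (h : CounterEx M γ f η T θ A) (hx : x ∈ T) : x.rank < η.rank :=
  h.isRanking.choose_spec.rank_lt h.1.2.2.1 hx

theorem CounterEx.rank_le {M : Set ZFSet.{u}} {γ f η T θ A : ZFSet.{u}}
    (h : CounterEx M γ f η T θ A) : T.rank ≤ η.rank :=
  ZFSet.rank_le_iff.2 fun _ hx => h.rank_lt hx

/-- Counterexamples are absolute to classes containing all sets of small rank. -/
theorem CounterEx.of_closed {M : Set ZFSet.{u}} {γ f η T θ A : ZFSet.{u}}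
    (h : CounterEx V γ f η T θ A)
    (hM : ∀ x : ZFSet.{u}, x.rank ≤ η.rank + Ordinal.omega0 + Ordinal.omega0 → x ∈ M) :
    CounterEx M γ f η T θ A := by
  refine ⟨h.1, ⟨_, hM _ ?_, isRanking_graph h.1.1 h.rank_le⟩, ?_⟩
  · rw [ZFSet.rank_le_iff]
    intro p hp
    obtain ⟨a, ha, rfl⟩ := mem_graph.1 hp
    have hlt := ((h.rank_lt ha).trans (lt_add_omega _)).trans (lt_add_omega _)
    exact rank_pair_lt (isSuccLimit_add_omega _) hlt (by rwa [Ordinal.rank_toZFSet])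
  · rintro ⟨I, -, U, -, hG⟩
    refine h.2.2 ⟨I, trivial, U, trivial, hG.of_closed h.1.2.2.1 h.1.2.2.2.1 fun x hx => hM x ?_⟩
    refine hx.trans ?_
    gcongr ?_ + _ + _
    exact h.rank_le

theorem CounterEx.hasCounterEx {M : Set ZFSet.{u}} {γ f η T θ A : ZFSet.{u}}
    (h : CounterEx M γ f η T θ A) (hM : ∀ x : ZFSet.{u}, x.rank ≤ η.rank → x ∈ M) :
    HasCounterEx M γ f η :=
  ⟨T, hM _ h.rank_le, θ, hM _ (h.rank_lt h.1.2.2.2.2.1).le, A,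
    hM _ (h.rank_lt h.1.2.2.2.2.2.1).le, h⟩

section Embedding

variable {M : Set ZFSet.{u}} (hM : TransClass M) (e : ClassEmb V M)
include hM

theorem ClassEmb.graph_total {D a : ZFSet.{u}} {F : ZFSet.{u} → ZFSet.{u}} (ha : a ∈ e.j D) :
    ∃ b, ZFSet.pair a b ∈ e.j (graph D F) := by
  have hS : Dfn.{u} 2 (fun _ v => ∀ x ∈ v 0, ∃ a b, ZFSet.pair a b ∈ v 1 ∧ a = x) := by
    repeat' first | apply Dfn.eq | apply Dfn.ex_pair | apply Dfn.allb
  obtain ⟨_, b, hb, rfl⟩ := (hS.transfer hM e ![D, graph D F]).1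
    (fun x hx => ⟨x, F x, pair_mem_graph.2 ⟨hx, rfl⟩, rfl⟩) a ha
  exact ⟨b, hb⟩

theorem ClassEmb.pair_mem_j_graph {D a b : ZFSet.{u}} {F : ZFSet.{u} → ZFSet.{u}} (ha : a ∈ D)
    (hja : e.j a = a) (hjb : e.j (F a) = F a) :
    ZFSet.pair a b ∈ e.j (graph D F) ↔ b = F a := by
  have h : ZFSet.pair a (F a) ∈ e.j (graph D F) := by
    have := (e.pair_mem_iff hM a (F a) (graph D F)).2 (pair_mem_graph.2 ⟨ha, rfl⟩)
    rwa [hja, hjb] at this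
  have hS : Dfn.{u} 1 (fun _ v => ∀ a b, ZFSet.pair a b ∈ v 0 →
      ∀ a' b', ZFSet.pair a' b' ∈ v 0 → a = a' → b = b') := by
    repeat' first | apply Dfn.eq | apply Dfn.all_pair | apply Dfn.imp
  refine ⟨fun hb => ?_, fun hb => hb ▸ h⟩
  refine (hS.transfer hM e ![graph D F]).1 ?_ a b hb a (F a) h rfl
  rintro a b hab a' b' hab' rfl
  exact (pair_mem_graph.1 hab).2.trans (pair_mem_graph.1 hab').2.symm

theorem ClassEmb.mem_j_graph {D p : ZFSet.{u}} {F : ZFSet.{u} → ZFSet.{u}}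
    (hp : p ∈ e.j (graph D F)) : ∃ a b, p = ZFSet.pair a b ∧ a ∈ e.j D := by
  have hS : Dfn.{u} 2 (fun _ v => ∀ p ∈ v 1, ∃ a b, p = ZFSet.pair a b ∧ a ∈ v 0) := by
    repeat' first | apply Dfn.mem | apply Dfn.ex_eq_pair | apply Dfn.allb
  refine (hS.transfer hM e ![D, graph D F]).1 (fun p hp => ?_) p hp
  obtain ⟨a, ha, rfl⟩ := mem_graph.1 hp
  exact ⟨a, F a, rfl, ha⟩

theorem ClassEmb.j_graph {D : ZFSet.{u}} {F : ZFSet.{u} → ZFSet.{u}} (hD : e.j D = D)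
    (h : ∀ a ∈ D, e.j a = a ∧ e.j (F a) = F a) : e.j (graph D F) = graph D F := by
  ext p
  rw [mem_graph]
  constructor
  · intro hp
    obtain ⟨a, b, rfl, ha⟩ := e.mem_j_graph hM hp
    rw [hD] at ha
    exact ⟨a, ha, by rw [(e.pair_mem_j_graph hM ha (h a ha).1 (h a ha).2).1 hp]⟩
  · rintro ⟨a, ha, rfl⟩
    exact (e.pair_mem_j_graph hM ha (h a ha).1 (h a ha).2).2 rfl

theorem ClassEmb.exists_hasCounterEx {κ γ f η : ZFSet.{u}} (hγ : e.j γ = γ) (hf : e.j f = f)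
    (hη : η ∈ e.j κ) (h : HasCounterEx M γ f η) : ∃ ξ ∈ κ, HasCounterEx V γ f ξ := by
  have hS : Dfn.{u} 3 (fun M v => ∃ η ∈ v 0, HasCounterEx M (v 1) (v 2) η) := by
    repeat' first | apply Dfn.hasCounterEx | apply Dfn.exb
  refine (hS.transfer hM e ![κ, γ, f]).2 ⟨η, hη, ?_⟩
  change HasCounterEx M (e.j γ) (e.j f) η
  rwa [hγ, hf]

end Embedding

theorem Supercompact.exists_classEmb {κ : ZFSet.{u}} (h : Supercompact κ) (o : Ordinal.{u}) :
    ∃ (M : Set ZFSet.{u}) (e : ClassEmb V M) (D : ZFSet.{u}), TransClass M ∧ CritPt e.j κ ∧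
      SeqClosed D M ∧ (∀ x : ZFSet.{u}, x.IsOrdinal → x.rank ≤ o → x ∈ e.j κ) ∧
      ∀ x : ZFSet.{u}, x.rank ≤ o → Cardinal.mk x.toSet ≤ Cardinal.mk D.toSet := by
  obtain ⟨D, hD, ho, hc⟩ := exists_isCard o
  obtain ⟨E⟩ := h D hD
  have hκ := (E.e.isOrdinal_iff E.trans κ).2 E.crit.1
  refine ⟨E.M, E.e, D, E.trans, E.crit, E.closed, fun x hx hxo => ?_, hc⟩
  rw [← hx.rank_lt_iff_mem hκ]
  refine hxo.trans_lt ?_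
  have := ZFSet.rank_lt_of_mem (hκ.mem_trans ho E.big)
  rwa [Ordinal.rank_toZFSet] at this

/-- Below a supercompact cardinal `κ` the function `menas` takes values in `V_κ`. -/
theorem Supercompact.rank_menas_lt {κ : ZFSet.{u}} (h : Supercompact κ) (γ : ZFSet.{u}) :
    γ ∈ κ → (menas γ).rank < κ.rank := by
  induction γ using ZFSet.inductionOn with
  | _ γ ih =>
    intro hγ
    by_cases hex : ∃ A, MinCounterEx V γ (graph γ menas) A
    · obtain ⟨η, -, ⟨T, -, θ, -, hC⟩, hmin⟩ := minCounterEx_menas hex.choose_spec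
      obtain ⟨M, e, D, hM, hκ, hD, hbig, hc⟩ :=
        h.exists_classEmb (η.rank + Ordinal.omega0 + Ordinal.omega0)
      have hmem := mem_of_rank_le hM e hD hc
      have hle : η.rank ≤ η.rank + Ordinal.omega0 + Ordinal.omega0 :=
        ((lt_add_omega _).trans (lt_add_omega _)).le
      have hγj := e.fix_of_rank_lt hM hκ γ (ZFSet.rank_lt_of_mem hγ)
      have hfj : e.j (graph γ menas) = graph γ menas := e.j_graph hM hγj fun a ha =>
        have ha' := hκ.1.mem_trans ha hγ
        ⟨e.fix_of_rank_lt hM hκ a (ZFSet.rank_lt_of_mem ha'), e.fix_of_rank_lt hM hκ _ (ih a ha ha')⟩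
      obtain ⟨ξ, hξ, hξC⟩ := e.exists_hasCounterEx hM hγj hfj (hbig η hC.1.1 hle)
        ((hC.of_closed hmem).hasCounterEx fun x hx => hmem x (hx.trans hle))
      have hξη := ((hκ.1.mem hξ).notMem_iff_subset hC.1.1).1 (hmin ξ trivial hξC)
      exact (hC.rank_lt hC.1.2.2.2.2.2.1).trans_le
        ((ZFSet.rank_mono hξη).trans (ZFSet.rank_lt_of_mem hξ).le)
    · rw [menas_eq_empty hex, ZFSet.rank_empty]
      exact zero_le.trans_lt (ZFSet.rank_lt_of_mem hγ)

theorem Supercompact.exists_scEmb {κ : ZFSet.{u}} (h : Supercompact κ) (θ₀ A : ZFSet.{u})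
    (hθ₀ : IsCard θ₀) : ∃ E : SCEmb κ θ₀, ZFSet.pair κ A ∈ E.e.j (graph κ menas) := by
  by_contra hE
  obtain ⟨hκo, hω⟩ : κ.IsOrdinal ∧ Ordinal.omega0.toZFSet ∈ κ := by
    obtain ⟨M, e, -, hM, hκ, -⟩ := h.exists_classEmb 0
    exact ⟨hκ.1, omega_mem_crit hM e hκ⟩
  set r := graph κ menas with hr
  set θ : ZFSet.{u} := (max κ.rank θ₀.rank + 1).toZFSet with hθ
  have hθo : θ.IsOrdinal := ZFSet.isOrdinal_toZFSet _
  have hκθ : κ ∈ θ := by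
    rw [← hκo.rank_lt_iff_mem hθo, hθ, Ordinal.rank_toZFSet, Order.lt_add_one_iff]
    exact le_max_left _ _
  have hθ₀θ : θ₀ ∈ θ := by
    rw [← hθ₀.1.rank_lt_iff_mem hθo, hθ, Ordinal.rank_toZFSet, Order.lt_add_one_iff]
    exact le_max_right _ _
  set T := ZFSet.vonNeumann (max θ.rank A.rank + 1) with hT
  have hTt : T.IsTransitive := ZFSet.isTransitive_vonNeumann _
  have hθT : θ ∈ T := by
    rw [hT, ZFSet.mem_vonNeumann, Order.lt_add_one_iff]
    exact le_max_left _ _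
  have hAT : A ∈ T := by
    rw [hT, ZFSet.mem_vonNeumann, Order.lt_add_one_iff]
    exact le_max_right _ _
  have hκT : κ ∈ T := hTt.subset_of_mem hθT hκθ
  have hC : CounterEx V κ r T.rank.toZFSet T θ A :=
    ⟨⟨ZFSet.isOrdinal_toZFSet _, hθo, hTt, hκT, hθT, hAT, hκθ⟩,
      ⟨_, trivial, isRanking_graph (ZFSet.isOrdinal_toZFSet _) (by rw [Ordinal.rank_toZFSet])⟩,
      fun ⟨I, _, U, _, hG⟩ => hE (hG.exists_scEmb hκo hω hTt hκT hθT hAT hκθ hθ₀θ)⟩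
  obtain ⟨M, e, D, hM, hκ, hD, hbig, hc⟩ :=
    h.exists_classEmb (T.rank + Ordinal.omega0 + Ordinal.omega0)
  have hmem := mem_of_rank_le hM e hD hc
  have hle : T.rank + Ordinal.omega0 ≤ T.rank + Ordinal.omega0 + Ordinal.omega0 :=
    (lt_add_omega _).le
  have hle' : T.rank ≤ T.rank + Ordinal.omega0 + Ordinal.omega0 := (lt_add_omega _).le.trans hle
  have hCM : CounterEx M κ r T.rank.toZFSet T θ A :=
    hC.of_closed (by rwa [Ordinal.rank_toZFSet])
  have hfix : ∀ a ∈ κ, e.j a = a ∧ e.j (menas a) = menas a := fun a ha =>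
    ⟨e.fix_of_rank_lt hM hκ a (ZFSet.rank_lt_of_mem ha),
      e.fix_of_rank_lt hM hκ _ (h.rank_menas_lt a ha)⟩
  have hres : IsRes (e.j r) κ r := by
    constructor
    · intro p hp
      obtain ⟨a, ha, rfl⟩ := mem_graph.1 hp
      exact ⟨(e.pair_mem_j_graph hM ha (hfix a ha).1 (hfix a ha).2).2 rfl, a, _, rfl, ha⟩
    · intro a b hab ha
      exact pair_mem_graph.2 ⟨ha, (e.pair_mem_j_graph hM ha (hfix a ha).1 (hfix a ha).2).1 hab⟩
  have hrM : r ∈ M := by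
    refine hmem r (ZFSet.rank_le_iff.2 fun p hp => ?_)
    obtain ⟨a, ha, rfl⟩ := mem_graph.1 hp
    have hlt : κ.rank < T.rank + Ordinal.omega0 + Ordinal.omega0 :=
      (ZFSet.rank_lt_of_mem hκT).trans_le hle'
    exact rank_pair_lt (isSuccLimit_add_omega _) ((ZFSet.rank_lt_of_mem ha).trans hlt)
      ((h.rank_menas_lt a ha).trans hlt)
  obtain ⟨A', hA'⟩ := e.graph_total hM (F := menas) hκ.2.1
  have hmenas : IsMenas M (e.j r) :=
    ((Dfn.isMenas 0).transfer hM e ![r]).1 (isMenas_graph hκo)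
  have hηC := hCM.hasCounterEx (by
    rw [Ordinal.rank_toZFSet]
    exact fun x hx => hmem x (hx.trans hle'))
  have hηM : T.rank.toZFSet ∈ M := hmem _ (by rwa [Ordinal.rank_toZFSet])
  obtain ⟨η', -, ⟨T', hT'M, θ', -, hC'⟩, hmin⟩ := hmenas κ A' hA' r hrM hres ⟨_, hηM, hηC⟩
  have hη' : η'.rank ≤ T.rank := by
    have := ZFSet.rank_mono
      (((ZFSet.isOrdinal_toZFSet _).notMem_iff_subset hC'.1.1).1 (hmin _ hηM hηC))
    rwa [Ordinal.rank_toZFSet] at this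
  have hT' : T'.rank ≤ T.rank := hC'.rank_le.trans hη'
  have hθ' : θ' ∈ e.j κ :=
    hbig θ' hC'.1.2.1 (((hC'.rank_lt hC'.1.2.2.2.2.1).le.trans hη').trans hle')
  obtain ⟨-, -, hT't, hκT', hθT', hAT', -⟩ := hC'.1
  have hS : ∀ p, p ∈ ZFSet.range (fun a : T' => ZFSet.pair (e.j a) a) ↔
      ∃ a ∈ T', p = ZFSet.pair (e.j a) a := fun p => by simp [eq_comm]
  have hSM : ZFSet.range (fun a : T' => ZFSet.pair (e.j a) a) ∈ M := by
    refine mem_of_seqClosed hM e hD (fun p hp => ?_) ?_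
    · obtain ⟨a, ha, rfl⟩ := (hS p).1 hp
      exact e.pair_mem_target hM (e.maps _ trivial) (hM _ hT'M _ ha)
    · refine le_trans ?_ (hc T' (hT'.trans hle'))
      refine Cardinal.mk_le_of_surjective
        (f := fun a : T'.toSet => ⟨ZFSet.pair (e.j a) a, (hS _).2 ⟨a, a.2, rfl⟩⟩) ?_
      rintro ⟨p, hp⟩
      obtain ⟨a, ha, rfl⟩ := (hS p).1 hp
      exact ⟨⟨a, ha⟩, rfl⟩
  obtain ⟨I, U, hI, hU, hG⟩ := exists_good hM e hκ hT't hκT' hθT' hAT' hθ' hA' hSM hS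
  have hle2 : ∀ n : ℕ, T'.rank + Ordinal.omega0 + n ≤
      T.rank + Ordinal.omega0 + Ordinal.omega0 := fun n => by
    gcongr
    exact (Ordinal.natCast_lt_omega0 n).le
  exact hC'.2.2 ⟨I, hmem I (hI.trans (by exact_mod_cast hle2 1)), U,
    hmem U (hU.trans (by exact_mod_cast hle2 2)), hG.relativize⟩

end LaverDiamond

open LaverDiamond

/-- Assuming the axiom of choice for classes (a well-ordering of the universe), the
universal principle `LD^sc` holds: there is a class function `ℓ : Ord → V` such that for
every supercompact cardinal `κ` the restriction `ℓ↾κ` is a `LD^sc_κ` Laver function. -/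
theorem universal_LDsc_of_classAC
    (hAC : ∃ W : ZFSet.{u} → ZFSet.{u} → Prop, IsWellOrder ZFSet.{u} W) :
    ∃ ℓ : ZFSet.{u} → ZFSet.{u}, UnivLDsc ℓ := by
  refine ⟨menas, fun κ h => ⟨graph κ menas, fun p => mem_graph, ⟨fun p hp => ?_, ?_⟩, ?_⟩⟩
  · obtain ⟨γ, hγ, rfl⟩ := mem_graph.1 hp
    exact ⟨γ, menas γ, hγ, h.rank_menas_lt γ hγ, rfl⟩
  · intro γ A B hA hB
    rw [(pair_mem_graph.1 hA).2, (pair_mem_graph.1 hB).2]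
  · exact fun θ A hθ _ => h.exists_scEmb θ A hθ
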